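/- arXiv:2209.05429 — 10 statements merged into one kernel-verified Lean document; each statement's English description precedes it below -/
import Mathlib

section
/- Fix N ≥ 1 and for m, n ∈ ℕ let E_{m,n} = Σ_{i=1}^{N} ( n·y_i^{n-1}·x_i^m·∂/∂x_i − m·x_i^{m-1}·y_i^n·∂/∂y_i ), a derivation of the polynomial ring ℂ[x_1,…,x_N, y_1,…,y_N]. Then: (1) for all m, n, m', n' one has [E_{m,n}, E_{m',n'}] = (m'n − mn')·E_{m+m'-1, n+n'-1} (the coefficient m'n − mn' vanishes whenever m+m' = 0 or n+n' = 0, so the index subtractions are unambiguous); and (2) each E_{m,n} preserves the ideal J_N of ℂ[x_1,…,x_N, y_1,…,y_N] generated by the S_N-antiinvariant polynomials, i.e. E_{m,n}(J_N) ⊆ J_N. -/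
open MvPolynomial

/-- The polynomial ring `ℂ[x_1,…,x_N,y_1,…,y_N]`: the variable `Sum.inl i` is `x_i`
and the variable `Sum.inr i` is `y_i`. -/
abbrev PolyXY (N : ℕ) := MvPolynomial (Fin N ⊕ Fin N) ℂ

/-- The derivation `E_{m,n} = Σ_i ( n y_i^{n-1} x_i^m ∂/∂x_i − m x_i^{m-1} y_i^n ∂/∂y_i )`;
a summand whose scalar coefficient vanishes is declared to be `0`, so no negative
exponents occur. -/
noncomputable def Eder (N m n : ℕ) : Derivation ℂ (PolyXY N) (PolyXY N) :=
  mkDerivation ℂ fun i =>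
    match i with
    | Sum.inl i => (n : PolyXY N) * X (Sum.inr i) ^ (n - 1) * X (Sum.inl i) ^ m
    | Sum.inr i => -((m : PolyXY N) * X (Sum.inl i) ^ (m - 1) * X (Sum.inr i) ^ n)

/-- A polynomial is `S_N`-antiinvariant if `σ·f = sign(σ)·f` for every permutation `σ`,
where `σ` acts by simultaneously permuting the `x` and `y` variables. -/
def IsAntiinvariant {N : ℕ} (f : PolyXY N) : Prop :=
  ∀ σ : Equiv.Perm (Fin N), rename (Sum.map σ σ) f = (Equiv.Perm.sign σ : ℤ) • f

/-- The ideal generated by the `S_N`-antiinvariant polynomials. -/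
noncomputable def antiinvariantIdeal (N : ℕ) : Ideal (PolyXY N) :=
  Ideal.span {f : PolyXY N | IsAntiinvariant f}

open MvPolynomial in
theorem Eder_inl (N m n : ℕ) (i : Fin N) : Eder N m n (X (Sum.inl i)) =
    (n : PolyXY N) * X (Sum.inr i) ^ (n - 1) * X (Sum.inl i) ^ m := by
  simp [Eder, mkDerivation_X]

open MvPolynomial in
theorem Eder_inr (N m n : ℕ) (i : Fin N) : Eder N m n (X (Sum.inr i)) =
    -((m : PolyXY N) * X (Sum.inl i) ^ (m - 1) * X (Sum.inr i) ^ n) := by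
  simp [Eder, mkDerivation_X]

open MvPolynomial in
theorem Eder_rename (N m n : ℕ) (σ : Equiv.Perm (Fin N)) (f : PolyXY N) :
    rename (Sum.map σ σ) (Eder N m n f) = Eder N m n (rename (Sum.map σ σ) f) := by
  induction f using MvPolynomial.induction_on with
  | C a =>
    have h : ∀ a : ℂ, Eder N m n (C a) = 0 := fun a => (Eder N m n).map_algebraMap a
    simp only [rename_C, h, map_zero]
  | add p q hp hq => simp only [map_add, hp, hq]
  | mul_X p i hp =>
    simp only [map_mul, rename_X, Derivation.leibniz, map_add, smul_eq_mul, hp]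
    rcases i with i | i <;>
      simp [Eder_inl, Eder_inr]

theorem Eder_lie_aux {R : Type*} [CommRing R] [Algebra ℂ R] (D : Derivation ℂ R R) (a : R) (k : ℕ) :
    D (a ^ k) = (k : R) * a ^ (k - 1) * D a := by
  rw [Derivation.leibniz_pow]; simp [mul_assoc]

theorem Eder_nat_aux {R : Type*} [CommRing R] [Algebra ℂ R] (D : Derivation ℂ R R) (k : ℕ) :
    D (k : R) = 0 := by
  simp

set_option maxHeartbeats 4000000 in
theorem Eder_bracket (N m n m' n' : ℕ) :
    ⁅Eder N m n, Eder N m' n'⁆ =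
        ((m' * n : ℤ) - (m * n' : ℤ)) • Eder N (m + m' - 1) (n + n' - 1) := by
  apply MvPolynomial.derivation_ext
  rintro (i | i)
  all_goals
    rw [Derivation.commutator_apply, Derivation.smul_apply]
    simp only [Eder_inl, Eder_inr, Derivation.leibniz, Eder_lie_aux, Eder_nat_aux, smul_eq_mul,
      map_neg, zsmul_eq_mul]
    generalize (X (Sum.inl i) : PolyXY N) = x
    generalize (X (Sum.inr i) : PolyXY N) = y
    rcases m with _ | _ | m <;> rcases n with _ | _ | n <;> rcases m' with _ | _ | m' <;>
      rcases n' with _ | _ | n' <;>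
    first
    | (simp; done)
    | (simp only [Nat.add_sub_cancel, show ∀ a b : ℕ, a + 1 + (b + 1) - 1 = a + b + 1 from fun a b => by omega,
        show ∀ a : ℕ, 0 + (a + 1) - 1 = a from fun a => by omega,
        show ∀ a : ℕ, (a + 1) + 0 - 1 = a from fun a => by omega]
       push_cast
       ring)

/-- (1) The operators `E_{m,n}` satisfy
`[E_{m,n}, E_{m',n'}] = (m' n − m n')·E_{m+m'-1, n+n'-1}`, and
(2) each `E_{m,n}` preserves the ideal generated by the antiinvariant polynomials. -/
theorem Eder_bracket_and_preserves_ideal (N : ℕ) (hN : 1 ≤ N) :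
    (∀ m n m' n' : ℕ,
      ⁅Eder N m n, Eder N m' n'⁆ =
        ((m' * n : ℤ) - (m * n' : ℤ)) • Eder N (m + m' - 1) (n + n' - 1)) ∧
    (∀ m n : ℕ, ∀ f ∈ antiinvariantIdeal N, Eder N m n f ∈ antiinvariantIdeal N) := by
  refine ⟨Eder_bracket N, fun m n f hf => ?_⟩
  unfold antiinvariantIdeal at hf ⊢
  induction hf using Submodule.span_induction with
  | mem g hg =>
    apply Ideal.subset_span
    intro σ
    rw [Eder_rename, hg σ, map_zsmul]
  | zero => simp
  | add p q _ _ hp hq => rw [map_add]; exact add_mem hp hq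
  | smul a p hp ih =>
    rw [smul_eq_mul, Derivation.leibniz, smul_eq_mul, smul_eq_mul]
    exact add_mem (Ideal.mul_mem_left _ _ ih) (Ideal.mul_mem_right _ _ hp)
end

section
/- Let H be a commutative ring. On the free H-module with basis the monomials x^m y^n (m, n ∈ ℕ), i.e. on the polynomial ring H[x,y], the bilinear bracket determined by [ξ·x^m y^n, η·x^{m'} y^{n'}] = (n m' − m n')·ξη·x^{m+m'} y^{n+n'-1} for ξ, η ∈ H (the coefficient n m' − m n' vanishes when n + n' = 0, so the index subtraction is unambiguous) is alternating and satisfies the Jacobi identity; hence it makes H[x,y] into a Lie ring (a Lie algebra over H). Equivalently, the bracket [f, g] = x·(∂f/∂y · ∂g/∂x − ∂f/∂x · ∂g/∂y) on H[x,y] satisfies the Jacobi identity. -/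
open MvPolynomial

/-- The bracket `[f, g] = x·(∂f/∂y · ∂g/∂x − ∂f/∂x · ∂g/∂y)` on `H[x,y]`,
where `x = X 0` and `y = X 1`. -/
noncomputable def wBracket {H : Type*} [CommRing H] (f g : MvPolynomial (Fin 2) H) :
    MvPolynomial (Fin 2) H :=
  X 0 * (pderiv 1 f * pderiv 0 g - pderiv 0 f * pderiv 1 g)

theorem pderiv_comm_aux {H : Type*} [CommRing H] (f : MvPolynomial (Fin 2) H) :
    pderiv 1 (pderiv 0 f) = pderiv 0 (pderiv 1 f) := by
  have h : ⁅(pderiv 1 : Derivation H (MvPolynomial (Fin 2) H) (MvPolynomial (Fin 2) H)),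
      (pderiv 0 : Derivation H (MvPolynomial (Fin 2) H) (MvPolynomial (Fin 2) H))⁆ = 0 := by
    apply MvPolynomial.derivation_ext
    intro i
    fin_cases i <;> simp [Derivation.commutator_apply, pderiv_X]
  have h2 := congrArg (fun D => D f) h
  simp only [Derivation.commutator_apply, Derivation.zero_apply] at h2
  exact sub_eq_zero.mp h2

/-- On the free `H`-module `H[x,y]` with basis the monomials `x^m y^n`, the bracket
determined by `[ξ x^m y^n, η x^{m'} y^{n'}] = (n m' − m n') ξη x^{m+m'} y^{n+n'-1}`
(equivalently, `[f,g] = x(∂_y f ∂_x g − ∂_x f ∂_y g)`) is alternating and satisfies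
the Jacobi identity, hence makes `H[x,y]` a Lie ring (a Lie algebra over `H`). -/
theorem wBracket_isLie (H : Type*) [CommRing H] :
    -- value on basis monomials
    (∀ (ξ η : H) (m n m' n' : ℕ),
      wBracket (C ξ * X 0 ^ m * X 1 ^ n) (C η * X 0 ^ m' * X 1 ^ n') =
        ((n * m' : ℤ) - (m * n' : ℤ)) •
          (C (ξ * η) * X 0 ^ (m + m') * X 1 ^ (n + n' - 1))) ∧
    -- bilinearity
    (∀ f g h : MvPolynomial (Fin 2) H,
      wBracket (f + g) h = wBracket f h + wBracket g h ∧
      wBracket f (g + h) = wBracket f g + wBracket f h ∧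
      ∀ c : H, wBracket (C c * f) g = C c * wBracket f g ∧
        wBracket f (C c * g) = C c * wBracket f g) ∧
    -- alternating
    (∀ f : MvPolynomial (Fin 2) H, wBracket f f = 0) ∧
    -- Jacobi identity
    (∀ f g h : MvPolynomial (Fin 2) H,
      wBracket f (wBracket g h) + wBracket g (wBracket h f) +
        wBracket h (wBracket f g) = 0) := by
  refine ⟨?_, ?_, ?_, ?_⟩
  · intro ξ η m n m' n'
    have h01 : pderiv (R := H) (0 : Fin 2) (X 1) = 0 := pderiv_X_of_ne (by decide)
    have h10 : pderiv (R := H) (1 : Fin 2) (X 0) = 0 := pderiv_X_of_ne (by decide)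
    simp only [wBracket, Derivation.leibniz, Derivation.leibniz_pow, pderiv_C, pderiv_X_self,
      h01, h10, smul_eq_mul, nsmul_eq_mul, zsmul_eq_mul, C_mul]
    rcases m with _ | m <;> rcases n with _ | n <;> rcases m' with _ | m' <;>
      rcases n' with _ | n' <;>
      simp only [Nat.add_sub_cancel, Nat.zero_add, Nat.add_zero, ← Nat.add_assoc,
        Nat.zero_sub] <;> push_cast <;> ring
  · intro f g h
    refine ⟨?_, ?_, fun c => ⟨?_, ?_⟩⟩ <;>
      simp only [wBracket, map_add, Derivation.leibniz, pderiv_C, smul_eq_mul] <;> ring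
  · intro f
    simp only [wBracket]
    ring
  · intro f g h
    have h10 : pderiv (R := H) (1 : Fin 2) (X 0) = 0 := pderiv_X_of_ne (by decide)
    simp only [wBracket, map_sub, Derivation.leibniz, pderiv_X_self, h10, smul_eq_mul,
      pderiv_comm_aux]
    ring
end

section
/- Let K be a field of characteristic zero, H a commutative unital K-algebra, and L a Lie algebra over K. Suppose given maps T, ψ : ℕ × H → L, K-linear in the H-argument, satisfying for all m, n, m₁, m₂, m₃ ∈ ℕ and all ξ, ξ', ξ'', η ∈ H: (i) [ψ_m(ξ), ψ_n(η)] = 0; (ii) [ψ_m(η), T_n(ξ)] = m·T_{m+n-1}(ηξ) for m ≥ 1, and [ψ_0(η), T_n(ξ)] = 0; (iii) [T_m(ξξ'), T_n(ξ'')] = [T_m(ξ), T_n(ξ'ξ'')]; (iv) [T_m(ξ), T_{n+3}(ξ')] − 3[T_{m+1}(ξ), T_{n+2}(ξ')] + 3[T_{m+2}(ξ), T_{n+1}(ξ')] − [T_{m+3}(ξ), T_n(ξ')] = 0; (v) Σ_{π ∈ S₃} [T_{m_{π(3)}}(ξ_{π(3)}), [T_{m_{π(2)}}(ξ_{π(2)}),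 T_{m_{π(1)}+1}(ξ_{π(1)})]] = 0, where π permutes simultaneously the indices m_i and the elements ξ_i. Define D_{m,n}(ξ) = (n!/(m+n)!)·(−ad_{T_0(1)})^m (ψ_{m+n}(ξ)) for m, n ∈ ℕ, ξ ∈ H. Then D_{0,n}(ξ) = ψ_n(ξ), D_{1,n}(ξ) = T_n(ξ), and for all m, n, m', n' ∈ ℕ and ξ, η ∈ H: if n + n' ≥ 1 then [D_{m,n}(ξ), D_{m',n'}(η)] = (n m' − m n')·D_{m+m', n+n'-1}(ξη), and if n = n' = 0 then [D_{m,0}(ξ), D_{m',0}(η)] = 0. -/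
/-- Combinatorial core: one-dimensionality of the quotient by deformed power sums. -/
lemma gen_core {K L : Type} [Field K] [CharZero K] [AddCommGroup L] [Module K L]
    (m : K) (hm0 : m ≠ 0) (hm1 : m - 1 ≠ 0) (b : ℕ → ℕ → L) (P : ℕ → L →ₗ[K] L)
    (hP : ∀ i j k, P i (b j k) = m • b (j + i) k + b j (k + i))
    (h00 : b 0 0 = 0) (j k : ℕ) :
    ((j + k : ℕ) : K) • b j k = ((j : K) - m * k) • b (j + k) 0 := by
  have e1 : ∀ k, m • b k 0 + b 0 k = 0 := by
    intro k
    have := hP k 0 0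
    rw [h00, map_zero] at this
    simpa using this.symm
  have e2 : ∀ j k, b k j + b j k = (1 - m) • b (k + j) 0 := by
    intro j k
    have h := congrArg (P j) (e1 k)
    rw [map_add, map_smul, hP, hP, map_zero] at h
    simp only [Nat.zero_add] at h
    have h' := e1 (k + j)
    refine smul_right_injective L hm0 ?_
    simp only
    linear_combination (norm := module) h - h'
  have e3 : ∀ i j k, b (k + i) j + b (j + i) k + b (k + j) i = (2 - m) • b (k + j + i) 0 := by
    intro i j k
    have h := congrArg (P i) (e2 j k)
    rw [map_add, map_smul, hP, hP, hP] at h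
    simp only [Nat.zero_add] at h
    have a1 := e2 (j + i) k
    have a2 := e2 (k + i) j
    rw [show k + (j + i) = k + j + i by ring] at a1
    rw [show j + (k + i) = k + j + i by ring] at a2
    refine smul_right_injective L hm1 ?_
    simp only
    linear_combination (norm := module) h - a1 - a2
  have e4 : ∀ N i, i + 1 ≤ N → b (N - (i + 1)) (i + 1) - b (N - i) i
      = b (N - 1) 1 - b N 0 := by
    intro N i hi
    obtain ⟨r, rfl⟩ := Nat.exists_eq_add_of_le hi
    have h := e3 r i 1
    have h' := e2 (i + 1) r
    rw [show i + 1 + r - (i + 1) = r by omega, show i + 1 + r - i = 1 + r by omega,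
      show i + 1 + r - 1 = i + r by omega]
    rw [show 1 + i + r = i + 1 + r by ring, show 1 + i = i + 1 by ring] at h
    rw [show r + (i + 1) = i + 1 + r by ring] at h'
    linear_combination (norm := module) h' - h
  have e5 : ∀ N i, i ≤ N → b (N - i) i = b N 0 + (i : K) • (b (N - 1) 1 - b N 0) := by
    intro N i
    induction i with
    | zero => intro _; simp
    | succ i ih =>
      intro hi
      have := e4 N i hi
      rw [ih (by omega)] at this
      push_cast
      linear_combination (norm := module) this
  have f1 := e5 (j + k) (j + k) le_rfl
  have f2 := e5 (j + k) k (by omega)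
  have f3 := e1 (j + k)
  rw [Nat.sub_self] at f1
  rw [Nat.add_sub_cancel] at f2
  rw [f2]
  rw [f1] at f3
  push_cast at f3 ⊢
  linear_combination (norm := module) (k : K) • f3

lemma quad_core {K L : Type} [Field K] [CharZero K] [AddCommGroup L] [Module K L]
    (F : ℕ → ℕ → L) (hanti : ∀ i j, F i j = - F j i)
    (h4 : ∀ m n, F m (n + 3) - 3 • F (m + 1) (n + 2) + 3 • F (m + 2) (n + 1) - F (m + 3) n = 0)
    (j k : ℕ) :
    ((j + k : ℕ) : K) • F j k = ((j : K) - k) • F (j + k) 0 := by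
  obtain ⟨N, hN⟩ : ∃ N, N = j + k := ⟨_, rfl⟩
  have h2 : (2 : K) ≠ 0 := two_ne_zero
  have key : ∃ a c : L, ∀ i, i ≤ N → F (N - i) i = F N 0 + (i : K) • a + ((i : K) * (i - 1)) • c := by
    refine ⟨F (N - 1) 1 - F N 0, (1 / 2 : K) • (F (N - 2) 2 - (2 : K) • F (N - 1) 1 + F N 0), ?_⟩
    intro i
    induction i using Nat.strong_induction_on with
    | _ i ih =>
      intro hi
      match i, ih, hi with
      | 0, _, _ => simp
      | 1, _, _ => simp
      | 2, _, _ =>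
        push_cast
        module
      | i + 3, ih, hi =>
        have a0 := ih i (by omega) (by omega)
        have a1 := ih (i + 1) (by omega) (by omega)
        have a2 := ih (i + 2) (by omega) (by omega)
        obtain ⟨r, rfl⟩ := Nat.exists_eq_add_of_le hi
        have h := h4 r i
        rw [show i + 3 + r - (i + 3) = r by omega]
        rw [show i + 3 + r - i = r + 3 by omega] at a0
        rw [show i + 3 + r - (i + 1) = r + 2 by omega] at a1
        rw [show i + 3 + r - (i + 2) = r + 1 by omega] at a2
        rw [a0, a1, a2] at h
        rw [← sub_eq_zero, ← h]
        push_cast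
        module
  obtain ⟨a, c, hac⟩ := key
  have hd : F j k = F N 0 + (k : K) • a + ((k : K) * (k - 1)) • c := by
    rw [← hac k (by omega), hN, Nat.add_sub_cancel]
  have g0 := hac N le_rfl
  rw [Nat.sub_self, hanti] at g0
  rw [← hN, hd]
  rcases Nat.lt_or_ge N 2 with hlt | hge
  · have : (k = 0 ∧ j = 0) ∨ (k = 0 ∧ j = 1) ∨ (k = 1 ∧ j = 0) := by omega
    rcases this with ⟨rfl, rfl⟩ | ⟨rfl, rfl⟩ | ⟨rfl, rfl⟩
    · subst hN; simp
    · subst hN; simp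
    · subst hN
      simp at g0 ⊢
      exact g0.symm
  · have g1 := hac (N - 1) (by omega)
    have g2 := hac 1 (by omega)
    rw [show N - (N - 1) = 1 by omega, hanti, g2] at g1
    rw [Nat.cast_sub (by omega)] at g1
    push_cast at g1
    have hNK : ((N : K) - 1) ≠ 0 := by
      have : ((N : K)) ≠ ((1 : ℕ) : K) := by
        rw [Ne, Nat.cast_inj]; omega
      rw [Nat.cast_one] at this
      exact sub_ne_zero.mpr this
    have hc : c = 0 := by
      refine (smul_eq_zero_iff_right (mul_ne_zero h2 hNK)).mp ?_
      linear_combination (norm := module) g1 - g0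
    subst hc
    have hjN : (j : K) = N - k := by rw [hN]; push_cast; ring
    rw [hjN]
    refine smul_right_injective L h2 ?_
    simp only
    linear_combination (norm := module) (-2 * (k:K)) • g0

/-- Given operators `T, ψ : ℕ × H → L` (linear in the `H`-argument) in a Lie algebra `L`
satisfying the surface-`W` relations (i)–(v), the elements
`D_{m,n}(ξ) = (n!/(m+n)!)·(−ad_{T₀(1)})^m (ψ_{m+n}(ξ))` satisfy `D_{0,n} = ψ_n`,
`D_{1,n} = T_n`, and the Hamiltonian-vector-field commutation relations. -/
theorem surfaceW_D_relations
    (K : Type) [Field K] [CharZero K]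
    (H : Type) [CommRing H] [Algebra K H]
    (L : Type) [LieRing L] [LieAlgebra K L]
    (T ψ : ℕ → H →ₗ[K] L)
    -- (i)
    (h1 : ∀ (m n : ℕ) (ξ η : H), ⁅ψ m ξ, ψ n η⁆ = 0)
    -- (ii), for m ≥ 1 and for m = 0
    (h2 : ∀ (m n : ℕ) (η ξ : H),
      ⁅ψ (m + 1) η, T n ξ⁆ = (m + 1) • T (m + n) (η * ξ))
    (h2' : ∀ (n : ℕ) (η ξ : H), ⁅ψ 0 η, T n ξ⁆ = 0)
    -- (iii)
    (h3 : ∀ (m n : ℕ) (ξ ξ' ξ'' : H),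
      ⁅T m (ξ * ξ'), T n ξ''⁆ = ⁅T m ξ, T n (ξ' * ξ'')⁆)
    -- (iv)
    (h4 : ∀ (m n : ℕ) (ξ ξ' : H),
      ⁅T m ξ, T (n + 3) ξ'⁆ - 3 • ⁅T (m + 1) ξ, T (n + 2) ξ'⁆
        + 3 • ⁅T (m + 2) ξ, T (n + 1) ξ'⁆ - ⁅T (m + 3) ξ, T n ξ'⁆ = 0)
    -- (v)
    (h5 : ∀ (m : Fin 3 → ℕ) (ξ : Fin 3 → H),
      ∑ π : Equiv.Perm (Fin 3),
        ⁅T (m (π 2)) (ξ (π 2)), ⁅T (m (π 1)) (ξ (π 1)), T (m (π 0) + 1) (ξ (π 0))⁆⁆ = 0)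
    -- the definition of D
    (D : ℕ → ℕ → H → L)
    (hD : ∀ (m n : ℕ) (ξ : H),
      D m n ξ = ((n.factorial : K) / ((m + n).factorial : K)) •
        ((-((LieAlgebra.ad K L (T 0 1) : Module.End K L))) ^ m) (ψ (m + n) ξ)) :
    (∀ (n : ℕ) (ξ : H), D 0 n ξ = ψ n ξ) ∧
    (∀ (n : ℕ) (ξ : H), D 1 n ξ = T n ξ) ∧
    (∀ (m n m' n' : ℕ) (ξ η : H), 1 ≤ n + n' →
      ⁅D m n ξ, D m' n' η⁆ =
        ((n * m' : ℤ) - (m * n' : ℤ)) • D (m + m') (n + n' - 1) (ξ * η)) ∧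
    (∀ (m m' : ℕ) (ξ η : H), ⁅D m 0 ξ, D m' 0 η⁆ = 0) := by
  have h2K : ∀ (m n : ℕ) (η ξ : H),
      ⁅ψ (m + 1) η, T n ξ⁆ = ((m : K) + 1) • T (m + n) (η * ξ) := by
    intro m n η ξ
    rw [h2, ← Nat.cast_smul_eq_nsmul K]
    push_cast
    rfl
  have hD0 : ∀ n ξ, D 0 n ξ = ψ n ξ := by
    intro n ξ
    rw [hD]
    have : ((n.factorial : ℕ) : K) ≠ 0 := Nat.cast_ne_zero.mpr (Nat.factorial_ne_zero n)
    simp [div_self this]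
  have hrec : ∀ m n ξ, ⁅D m (n + 1) ξ, T 0 1⁆ = ((n : K) + 1) • D (m + 1) n ξ := by
    intro m n ξ
    rw [hD, hD, pow_succ', show m + 1 + n = m + (n + 1) by ring, smul_lie, smul_smul,
      Nat.factorial_succ n]
    rw [Module.End.mul_apply]
    generalize ((-((LieAlgebra.ad K L (T 0 1) : Module.End K L))) ^ m) (ψ (m + (n + 1)) ξ) = x
    rw [LinearMap.neg_apply, LieAlgebra.ad_apply, lie_skew]
    push_cast
    rw [mul_div_assoc]
  have hcast : ∀ n : ℕ, (n : K) + 1 ≠ 0 := fun n => Nat.cast_add_one_ne_zero n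
  have hD1 : ∀ n ξ, D 1 n ξ = T n ξ := by
    intro n ξ
    have h := hrec 0 n ξ
    rw [hD0, h2K] at h
    simp only [Nat.add_zero, mul_one, Nat.zero_add] at h
    exact (smul_right_injective L (hcast n) h).symm
  -- the step for the action of ψ
  have hSstep : ∀ m : ℕ,
      (∀ k n η ξ, ⁅ψ (k + 1) η, D m n ξ⁆ = (((k : K) + 1) * m) • D m (n + k) (η * ξ)) →
      (∀ n l p ξ η, n + l = p + 1 →
        ⁅D m n ξ, T l η⁆ = ((n : K) - m * l) • D (m + 1) p (ξ * η)) →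
      (∀ k n η ξ, ⁅ψ (k + 1) η, D (m + 1) n ξ⁆
        = (((k : K) + 1) * ((m + 1 : ℕ) : K)) • D (m + 1) (n + k) (η * ξ)) := by
    intro m hS hC k n η ξ
    refine smul_right_injective L (hcast n) ?_
    simp only
    rw [← lie_smul, ← hrec, leibniz_lie, hS, h2K, smul_lie, lie_smul,
      show n + 1 + k = n + k + 1 by ring, hrec, mul_one, Nat.add_zero k,
      hC (n + 1) k (n + k) ξ η (by ring), mul_comm ξ η]
    push_cast
    module
  -- C 1
  have hC1 : (∀ n l p ξ η, n + l = p + 1 →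
        ⁅T n ξ, T l η⁆ = ((n : K) - l) • D 2 p (ξ * η)) ∧ ∀ ξ η, ⁅T 0 ξ, T 0 η⁆ = 0 := by
    have hprod : ∀ n l ξ η, ⁅T n ξ, T l η⁆ = ⁅T n (ξ * η), T l 1⁆ := by
      intro n l ξ η
      rw [h3, mul_one]
    have hanti : ∀ ζ n l, ⁅T n ζ, T l 1⁆ = - ⁅T l ζ, T n 1⁆ := by
      intro ζ n l
      rw [lie_skew, hprod n l 1 ζ, one_mul]
    constructor
    · intro n l p ξ η hp
      have h := quad_core (K := K) (fun i j => ⁅T i (ξ * η), T j 1⁆) (hanti (ξ * η))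
        (fun m n => h4 m n _ _) n l
      rw [hp, ← hD1 (p + 1), hrec] at h
      rw [hprod]
      refine smul_right_injective L (hcast p) ?_
      simp only
      push_cast at h
      rw [h]
      module
    · intro ξ η
      rw [hprod]
      have h := hanti (ξ * η) 0 0
      refine (smul_eq_zero_iff_right (two_ne_zero (α := K))).mp ?_
      linear_combination (norm := module) h
  -- the lowest bracket only depends on the product
  have hBprod : ∀ m : ℕ,
      (∀ n l p ξ η, n + l = p + 1 →
        ⁅D m n ξ, T l η⁆ = ((n : K) - m * l) • D (m + 1) p (ξ * η)) →
      ∀ ζ η, ⁅D (m + 1) 0 ζ, T 0 η⁆ = ⁅D (m + 1) 0 (ζ * η), T 0 1⁆ := by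
    intro m hC ζ η
    have a := hC 1 0 0 ζ 1 rfl
    have b := hC 1 0 0 ζ η rfl
    simp only [Nat.cast_one, Nat.cast_zero, mul_zero, sub_zero, one_smul, mul_one] at a b
    have j := leibniz_lie (D m 1 ζ) (T 0 1) (T 0 η)
    rw [hC1.2, lie_zero, a, b, ← lie_skew (T 0 1)] at j
    rw [← sub_eq_zero, sub_eq_add_neg]
    exact j.symm
  have hB2 : ∀ ζ η, ⁅D 2 0 ζ, T 0 η⁆ = 0 := by
    have hp := hBprod 1 (by
      intro n l p ξ η h
      rw [hD1, hC1.1 n l p ξ η h]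
      simp)
    have hG : ∀ x y z, ⁅T 0 x, ⁅T 0 y, T (0 + 1) z⁆⁆ = ⁅D 2 0 (x * y * z), T 0 1⁆ := by
      intro x y z
      rw [hC1.1 0 1 0 y z rfl]
      simp only [Nat.cast_zero, Nat.cast_one, zero_sub, neg_smul, one_smul, lie_neg]
      rw [lie_skew, hp]
      rw [show y * z * x = x * y * z by ring]
    intro ζ η
    rw [hp]
    have h := h5 (fun _ => 0) ![ζ * η, 1, 1]
    have hu : ∀ π : Equiv.Perm (Fin 3), (![ζ * η, 1, 1] : Fin 3 → H) (π 2) *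
        (![ζ * η, 1, 1] : Fin 3 → H) (π 1) * (![ζ * η, 1, 1] : Fin 3 → H) (π 0) = ζ * η := by
      intro π
      have := Equiv.prod_comp π (![ζ * η, 1, 1] : Fin 3 → H)
      rw [Fin.prod_univ_three, Fin.prod_univ_three] at this
      simp only [Matrix.cons_val_zero, Matrix.cons_val_one, Matrix.cons_val, mul_one] at this
      refine Eq.trans ?_ this
      ring
    simp only [hG, hu] at h
    rw [Finset.sum_const, ← Nat.cast_smul_eq_nsmul K] at h
    refine (smul_eq_zero_iff_right ?_).mp h
    rw [Nat.cast_ne_zero]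
    exact Finset.card_ne_zero.mpr Finset.univ_nonempty
  -- higher vanishing
  have hBhigh : ∀ q : ℕ,
      (∀ n l p ξ η, n + l = p + 1 →
        ⁅D (q + 1) n ξ, T l η⁆ = ((n : K) - ((q + 1 : ℕ) : K) * l) • D (q + 2) p (ξ * η)) →
      (∀ n l p ξ η, n + l = p + 1 →
        ⁅D (q + 2) n ξ, T l η⁆ = ((n : K) - ((q + 2 : ℕ) : K) * l) • D (q + 3) p (ξ * η)) →
      (∀ ξ η, ⁅D (q + 2) 0 ξ, T 0 η⁆ = 0) →
      ∀ ζ η, ⁅D (q + 3) 0 ζ, T 0 η⁆ = 0 := by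
    intro q hCa hCb hb0 ζ η
    rw [hBprod (q + 2) hCb]
    generalize ζ * η = ζ
    have hY : ⁅D (q + 1) 1 ζ, T 0 1⁆ = D (q + 2) 0 ζ := by
      rw [hCa 1 0 0 ζ 1 rfl]; simp
    have hZ : D 2 0 1 = ⁅T 1 1, T 0 1⁆ := by
      rw [hC1.1 1 0 0 1 1 rfl]; simp
    have hX1 : ⁅T 1 1, D (q + 1) 1 ζ⁆ = (q : K) • D (q + 2) 1 ζ := by
      rw [← lie_skew, hCa 1 1 1 ζ 1 rfl, mul_one]
      push_cast
      module
    have hX0 : ⁅T 0 1, D (q + 1) 1 ζ⁆ = - D (q + 2) 0 ζ := by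
      rw [← lie_skew, hY]
    have hW1 : ⁅T 0 1, D (q + 2) 1 ζ⁆ = - D (q + 3) 0 ζ := by
      rw [← lie_skew, hCb 1 0 0 ζ 1 rfl]; simp
    have hY1 : ⁅T 1 1, D (q + 2) 0 ζ⁆ = ((q : K) + 2) • D (q + 3) 0 ζ := by
      rw [← lie_skew, hCb 0 1 0 ζ 1 rfl, mul_one]
      push_cast
      module
    have hY0 : ⁅T 0 1, D (q + 2) 0 ζ⁆ = 0 := by
      rw [← lie_skew, hb0, neg_zero]
    have hZX : ⁅D 2 0 1, D (q + 1) 1 ζ⁆ = (-2 : K) • D (q + 3) 0 ζ := by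
      rw [hZ, lie_lie, hX0, hX1, lie_neg, hY1, lie_smul, hW1]
      module
    have hZY : ⁅D 2 0 1, D (q + 2) 0 ζ⁆ = ((q : K) + 2) • ⁅D (q + 3) 0 ζ, T 0 1⁆ := by
      rw [hZ, lie_lie, hY0, hY1, lie_zero, lie_smul, ← lie_skew]
      module
    have hZY2 : ⁅D 2 0 1, D (q + 2) 0 ζ⁆ = (-2 : K) • ⁅D (q + 3) 0 ζ, T 0 1⁆ := by
      rw [← hY, leibniz_lie, hB2, lie_zero, add_zero, hZX, smul_lie]
    have h4q : ((q + 4 : ℕ) : K) ≠ 0 := Nat.cast_ne_zero.mpr (by omega)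
    refine (smul_eq_zero_iff_right h4q).mp ?_
    push_cast
    linear_combination (norm := module) hZY2 - hZY
  -- from the lowest bracket to all brackets
  have hCstep : ∀ m : ℕ, 2 ≤ m →
      (∀ k n η ξ, ⁅ψ (k + 1) η, D m n ξ⁆ = (((k : K) + 1) * m) • D m (n + k) (η * ξ)) →
      (∀ ζ η, ⁅D m 0 ζ, T 0 η⁆ = 0) →
      (∀ n l p ξ η, n + l = p + 1 →
        ⁅D m n ξ, T l η⁆ = ((n : K) - m * l) • D (m + 1) p (ξ * η)) := by
    intro m hm hS hb0
    have hm0 : (m : K) ≠ 0 := Nat.cast_ne_zero.mpr (by omega)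
    have hm1 : (m : K) - 1 ≠ 0 := by
      have : ((m : K)) ≠ ((1 : ℕ) : K) := by
        rw [Ne, Nat.cast_inj]; omega
      rw [Nat.cast_one] at this
      exact sub_ne_zero.mpr this
    obtain ⟨B, hB⟩ : ∃ B : ℕ → ℕ → H → H → L, ∀ n l ζ η, B n l ζ η = ⁅D m n ζ, T l η⁆ :=
      ⟨fun n l ζ η => ⁅D m n ζ, T l η⁆, fun _ _ _ _ => rfl⟩
    obtain ⟨P, hPdef⟩ : ∃ P : ℕ → H → L →ₗ[K] L,
        ∀ k θ, P k θ = ((k : K) + 1)⁻¹ • (LieAlgebra.ad K L (ψ (k + 1) θ) : Module.End K L) :=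
      ⟨_, fun _ _ => rfl⟩
    have hP : ∀ k θ n l ζ η, P k θ (B n l ζ η)
        = (m : K) • B (n + k) l (θ * ζ) η + B n (l + k) ζ (θ * η) := by
      intro k θ n l ζ η
      rw [hPdef, LinearMap.smul_apply, LieAlgebra.ad_apply, hB, hB, hB, leibniz_lie, hS, h2K,
        smul_lie, lie_smul, smul_add, smul_smul, smul_smul, ← mul_assoc,
        inv_mul_cancel₀ (hcast k), one_mul, one_smul, Nat.add_comm k l]
    have h00 : ∀ ζ η, B 0 0 ζ η = 0 := by
      intro ζ η
      rw [hB, hb0]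
    have e1 : ∀ k θ ζ η, (m : K) • B k 0 (θ * ζ) η + B 0 k ζ (θ * η) = 0 := by
      intro k θ ζ η
      have h := hP k θ 0 0 ζ η
      rw [h00, map_zero] at h
      simpa using h.symm
    have e1a : ∀ k ζ η, B k 0 ζ η = B k 0 (ζ * η) 1 := by
      intro k ζ η
      have a := e1 k η ζ 1
      have b := e1 k 1 ζ η
      rw [mul_one, mul_comm η ζ] at a
      rw [one_mul, one_mul] at b
      refine smul_right_injective L hm0 ?_
      simp only
      linear_combination (norm := module) b - a
    have e2 : ∀ j k θ ζ η, B k j ζ (θ * η) + B j k (θ * ζ) η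
        = (1 - (m : K)) • B (k + j) 0 (θ * ζ * η) 1 := by
      intro j k θ ζ η
      have b := e1 k 1 ζ η
      rw [one_mul, one_mul] at b
      have h := congrArg (P j θ) b
      rw [map_add, map_smul, hP, hP, map_zero] at h
      simp only [Nat.zero_add] at h
      have c := e1 (k + j) θ ζ η
      rw [e1a (k + j) (θ * ζ) η] at h c
      refine smul_right_injective L hm0 ?_
      simp only
      linear_combination (norm := module) h - c
    have e3 : ∀ k j ζ η, B k j ζ η = B k j (ζ * η) 1 := by
      intro k j ζ η
      have a := e2 j k η ζ 1
      have b := e2 j k 1 (ζ * η) 1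
      simp only [mul_one, one_mul] at a b
      rw [mul_comm η ζ] at a
      linear_combination (norm := module) a - b
    intro n l p ξ η hp
    have g := gen_core (K := K) (m : K) hm0 hm1 (fun j k => B j k (ξ * η) 1) (fun i => P i 1)
      (by
        intro i j k
        simp only [hP, one_mul]) (h00 _ _) n l
    rw [hp, hB (p + 1), hrec] at g
    rw [← hB, e3]
    refine smul_right_injective L (hcast p) ?_
    simp only
    push_cast at g
    rw [g]
    module
  have hall : ∀ m : ℕ,
      (∀ k n η ξ, ⁅ψ (k + 1) η, D m n ξ⁆ = (((k : K) + 1) * m) • D m (n + k) (η * ξ)) ∧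
      (∀ n l p ξ η, n + l = p + 1 →
        ⁅D m n ξ, T l η⁆ = ((n : K) - m * l) • D (m + 1) p (ξ * η)) ∧
      (∀ ζ η, ⁅D m 0 ζ, T 0 η⁆ = 0) := by
    intro m
    induction m using Nat.strong_induction_on with
    | _ m ih =>
      have hS : ∀ k n η ξ, ⁅ψ (k + 1) η, D m n ξ⁆
          = (((k : K) + 1) * m) • D m (n + k) (η * ξ) := by
        match m, ih with
        | 0, _ =>
          intro k n η ξ
          rw [hD0, h1]
          simp
        | m + 1, ih => exact hSstep m (ih m (by omega)).1 (ih m (by omega)).2.1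
      refine ⟨hS, ?_⟩
      match m, ih, hS with
      | 0, _, _ =>
        constructor
        · intro n l p ξ η hp
          rw [hD0]
          match n, hp with
          | 0, _ => rw [h2']; simp
          | n + 1, hp =>
            rw [h2K, Nat.zero_add, hD1, show n + l = p by omega]
            push_cast
            module
        · intro ζ η
          rw [hD0, h2']
      | 1, _, _ =>
        constructor
        · intro n l p ξ η hp
          rw [hD1, hC1.1 n l p ξ η hp]
          simp
        · intro ζ η
          rw [hD1, hC1.2]
      | 2, _, hS => exact ⟨hCstep 2 le_rfl hS hB2, hB2⟩
      | q + 3, ih, hS =>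
        have hb := hBhigh q (ih (q + 1) (by omega)).2.1 (ih (q + 2) (by omega)).2.1
          (ih (q + 2) (by omega)).2.2
        exact ⟨hCstep (q + 3) (by omega) hS hb, hb⟩
  have hS0 : ∀ m n η ξ, ⁅ψ 0 η, D m n ξ⁆ = 0 := by
    intro m
    induction m with
    | zero => intro n η ξ; rw [hD0, h1]
    | succ m ih =>
      intro n η ξ
      refine (smul_eq_zero_iff_right (hcast n)).mp ?_
      rw [← lie_smul, ← hrec, leibniz_lie, ih, h2', zero_lie, lie_zero, add_zero]
  have hrec' : ∀ m n ξ, ⁅D m n ξ, T 0 1⁆ = (n : K) • D (m + 1) (n - 1) ξ := by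
    intro m n ξ
    cases n with
    | zero => rw [(hall m).2.2]; simp
    | succ n => rw [hrec]; push_cast; rfl
  have hfin : ∀ m' m n n' ξ η, ⁅D m n ξ, D m' n' η⁆
      = ((n : K) * m' - m * n') • D (m + m') (n + n' - 1) (ξ * η) := by
    intro m'
    induction m' with
    | zero =>
      intro m n n' ξ η
      rw [hD0, ← lie_skew]
      cases n' with
      | zero => rw [hS0]; simp
      | succ k =>
        rw [(hall m).1, mul_comm η ξ, show n + (k + 1) - 1 = n + k by omega, Nat.add_zero]
        push_cast
        module
    | succ m' ih =>
      intro m n n' ξ η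
      refine smul_right_injective L (hcast n') ?_
      simp only
      rw [← lie_smul, ← hrec, leibniz_lie, ih, hrec', smul_lie, hrec', lie_smul,
        ← lie_skew (D m' (n' + 1) η), ih]
      cases n with
      | zero =>
        rw [show m + m' + 1 = m + (m' + 1) by ring, show 0 + (n' + 1) - 1 - 1 = 0 + n' - 1 by omega,
          show 0 + (n' + 1) - 1 = n' by omega]
        push_cast
        module
      | succ n =>
        rw [show m + m' + 1 = m + (m' + 1) by ring, show m + 1 + m' = m + (m' + 1) by ring,
          show n + 1 + (n' + 1) - 1 - 1 = n + n' by omega,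
          show n + 1 + (n' + 1) - 1 = n + n' + 1 by omega,
          show n + 1 - 1 + (n' + 1) - 1 = n + n' by omega,
          show n + 1 + n' - 1 = n + n' by omega, Nat.add_sub_cancel]
        push_cast
        module
  refine ⟨hD0, hD1, ?_, ?_⟩
  · intro m n m' n' ξ η _
    rw [hfin, ← Int.cast_smul_eq_zsmul K]
    push_cast
    rfl
  · intro m m' ξ η
    rw [hfin]
    simp
end

section
/- Let V be a vector space over a field of characteristic zero, let k ≥ 1, and let a_0, a_1, …, a_k ∈ V be a finite sequence satisfying: (1) a_{i+3} − 3·a_{i+2} + 3·a_{i+1} − a_i = 0 for all 0 ≤ i ≤ k − 3 (vanishing of third differences), and (2) a_i = −a_{k-i} for all 0 ≤ i ≤ k. Then k·a_i = (2i − k)·a_k for all 0 ≤ i ≤ k; in particular a_i = ((i − (k−i))/k)·a_k. -/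
/-- If a finite sequence `a_0, …, a_k` in a vector space over a field of characteristic
zero has vanishing third differences and satisfies `a_i = −a_{k−i}`, then
`k·a_i = (2i − k)·a_k` for all `0 ≤ i ≤ k`. -/
theorem third_differences_antisymmetric
    (K : Type) [Field K] [CharZero K]
    (V : Type) [AddCommGroup V] [Module K V]
    (k : ℕ) (hk : 1 ≤ k) (a : ℕ → V)
    (h3 : ∀ i : ℕ, i + 3 ≤ k →
      a (i + 3) - 3 • a (i + 2) + 3 • a (i + 1) - a i = 0)
    (hanti : ∀ i : ℕ, i ≤ k → a i = -a (k - i)) :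
    ∀ i : ℕ, i ≤ k → k • a i = ((2 * i : ℤ) - (k : ℤ)) • a k := by
  have he : ∀ i : ℕ, i + 2 ≤ k →
      a (i + 2) - 2 • a (i + 1) + a i = a 2 - 2 • a 1 + a 0 := by
    intro i
    induction i with
    | zero => intro _; rfl
    | succ n ih =>
      intro hn
      have h := h3 n (by omega)
      rw [← ih (by omega), ← sub_eq_zero, ← h]
      simp only [show n + 1 + 2 = n + 3 by omega, show n + 1 + 1 = n + 2 by omega]
      module
  have he0 : 2 ≤ k → a 2 - 2 • a 1 + a 0 = 0 := by
    intro h2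
    have h := he (k - 2) (by omega)
    have b0 := hanti 0 (by omega)
    have b1 := hanti 1 (by omega)
    have b2 := hanti 2 (by omega)
    rw [show k - 2 + 2 = k - 0 by omega, show k - 2 + 1 = k - 1 by omega] at h
    have h' : a 2 - 2 • a 1 + a 0 = -(a 2 - 2 • a 1 + a 0) := by
      nth_rewrite 1 [b0, b1, b2]
      rw [← h]
      module
    have h4 : (2 : K) • (a 2 - 2 • a 1 + a 0) = 0 := by
      rw [two_smul]
      nth_rewrite 1 [h']
      exact neg_add_cancel _
    exact (smul_eq_zero.mp h4).resolve_left two_ne_zero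
  have hlin : ∀ i : ℕ, (i ≤ k → a i = a 0 + (i : ℤ) • (a 1 - a 0)) ∧
      (i + 1 ≤ k → a (i + 1) = a 0 + ((i + 1 : ℕ) : ℤ) • (a 1 - a 0)) := by
    intro i
    induction i with
    | zero => constructor <;> intro _ <;> simp
    | succ n ih =>
      refine ⟨ih.2, fun hn => ?_⟩
      have h := (he n (by omega)).trans (he0 (by omega))
      have h1 := ih.1 (by omega)
      have h2 := ih.2 (by omega)
      have h5 : a (n + 1 + 1) = 2 • a (n + 1) - a n := by
        rw [← sub_eq_zero, ← h]
        module
      rw [h5, h1, h2]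
      push_cast
      module
  intro i hi
  have hi' := (hlin i).1 hi
  have hk' := (hlin k).1 le_rfl
  have h0 : a 0 = - a k := by simpa using hanti 0 (by omega)
  have hd : (k : ℤ) • (a 1 - a 0) = a k - a 0 := by
    rw [hk', add_sub_cancel_left]
  have hak : a k = - a 0 := by rw [h0, neg_neg]
  rw [← natCast_zsmul, hi', smul_add, smul_comm, hd, hak]
  module
end

section
/- In the field F = ℚ(t₁, t₂, x₁, x₂, x₃) of rational functions in five variables over ℚ, set Ω_{ij} = ((x_i^{-1} − x_j^{-1} − t₁)(x_i^{-1} − x_j^{-1} − t₂))^{-1} for i ≠ j. Then the following identity holds: (x₁^{-1} − 2·x₂^{-1} + x₃^{-1})·(Ω₁₂·Ω₂₃ − t₁t₂·Ω₁₂·Ω₂₃·Ω₁₃) = (x₃^{-1} − x₁^{-1})·(Ω₁₂·Ω₁₃ − Ω₂₃·Ω₁₃). -/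
noncomputable section

/-- The field `ℚ(t₁, t₂, x₁, x₂, x₃)` of rational functions in five variables over `ℚ`. -/
abbrev RatFunc5 := FractionRing (MvPolynomial (Fin 5) ℚ)

/-- The five variables, as elements of the rational function field. -/
def var (i : Fin 5) : RatFunc5 :=
  algebraMap (MvPolynomial (Fin 5) ℚ) RatFunc5 (MvPolynomial.X i)

/-- `t₁ = var 0`, `t₂ = var 1`, `x₁ = var 2`, `x₂ = var 3`, `x₃ = var 4`. -/
def t₁ : RatFunc5 := var 0
def t₂ : RatFunc5 := var 1
def x₁ : RatFunc5 := var 2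
def x₂ : RatFunc5 := var 3
def x₃ : RatFunc5 := var 4

/-- `Ω_{ij} = ((x_i⁻¹ − x_j⁻¹ − t₁)(x_i⁻¹ − x_j⁻¹ − t₂))⁻¹`. -/
def Om (u v : RatFunc5) : RatFunc5 :=
  ((u⁻¹ - v⁻¹ - t₁) * (u⁻¹ - v⁻¹ - t₂))⁻¹

theorem var_ne_zero' (i : Fin 5) : var i ≠ 0 := by
  unfold var
  rw [Ne, IsFractionRing.to_map_eq_zero_iff]
  exact MvPolynomial.X_ne_zero i

theorem factor_ne_zero (i j k : Fin 5) (hij : i ≠ j) :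
    (var i)⁻¹ - (var j)⁻¹ - var k ≠ 0 := by
  intro h
  have hi := var_ne_zero' i
  have hj := var_ne_zero' j
  have h2 : var j - var i - var k * (var i * var j) = 0 := by
    have h3 : var j - var i - var k * (var i * var j) =
        ((var i)⁻¹ - (var j)⁻¹ - var k) * (var i * var j) := by
      field_simp
    rw [h3, h, zero_mul]
  unfold var at h2
  simp only [← map_mul, ← map_sub] at h2
  rw [IsFractionRing.to_map_eq_zero_iff] at h2
  have h4 := congrArg (MvPolynomial.eval (fun m : Fin 5 => if m = j then (1 : ℚ) else 0)) h2
  simp [hij] at h4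

theorem cubic_aux {K : Type*} [Field K] (a b c s t : K)
    (h1 : a - b - s ≠ 0) (h2 : a - b - t ≠ 0) (h3 : b - c - s ≠ 0) (h4 : b - c - t ≠ 0)
    (h5 : a - c - s ≠ 0) (h6 : a - c - t ≠ 0) :
    (a - 2 * b + c) *
        (((a - b - s) * (a - b - t))⁻¹ * ((b - c - s) * (b - c - t))⁻¹ -
          s * t * (((a - b - s) * (a - b - t))⁻¹ * ((b - c - s) * (b - c - t))⁻¹ *
            ((a - c - s) * (a - c - t))⁻¹)) =
      (c - a) * (((a - b - s) * (a - b - t))⁻¹ * ((a - c - s) * (a - c - t))⁻¹ -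
        ((b - c - s) * (b - c - t))⁻¹ * ((a - c - s) * (a - c - t))⁻¹) := by
  field_simp
  ring

/-- The rational-function identity used in the verification of the cubic relation Q3:
`(x₁⁻¹ − 2x₂⁻¹ + x₃⁻¹)(Ω₁₂Ω₂₃ − t₁t₂Ω₁₂Ω₂₃Ω₁₃) = (x₃⁻¹ − x₁⁻¹)(Ω₁₂Ω₁₃ − Ω₂₃Ω₁₃)`. -/
theorem omega_cubic_identity :
    (x₁⁻¹ - 2 * x₂⁻¹ + x₃⁻¹) *
        (Om x₁ x₂ * Om x₂ x₃ - t₁ * t₂ * (Om x₁ x₂ * Om x₂ x₃ * Om x₁ x₃)) =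
      (x₃⁻¹ - x₁⁻¹) * (Om x₁ x₂ * Om x₁ x₃ - Om x₂ x₃ * Om x₁ x₃) := by
  unfold Om
  apply cubic_aux <;> exact factor_ne_zero _ _ _ (by decide)

end
end

section
/- Let V = ⊕_{i∈ℤ} V_i be a finite-dimensional ℤ-graded complex vector space (only finitely many V_i are nonzero). Let e ∈ End(V) be homogeneous of degree 2, i.e. e(V_i) ⊆ V_{i+2}, and let h ∈ End(V) be the grading operator, h(v) = i·v for v ∈ V_i. Then the following are equivalent: (a) for every k ≥ 0 the map e^k restricts to a linear isomorphism V_{-k} → V_k; (b) there exists f ∈ End(V) homogeneous of degree −2 (f(V_i) ⊆ V_{i-2}) such that [h, e] = 2e, [h, f] = −2f, and [e, f] = h, i.e. (e, f, h) is an sl₂-triple acting on V. -/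
section HL
variable {V : Type} [AddCommGroup V] [Module ℂ V]

lemma hl_pow_mem (W : ℤ → Submodule ℂ V) (e : Module.End ℂ V) (d : ℤ)
    (he : ∀ i, ∀ v ∈ W i, e v ∈ W (i + d)) (n : ℕ) :
    ∀ i, ∀ v ∈ W i, (e ^ n) v ∈ W (i + n * d) := by
  induction n with
  | zero => intro i v hv; simpa using hv
  | succ n ih =>
    intro i v hv
    rw [pow_succ', Module.End.mul_apply]
    have := he _ _ (ih i v hv)
    convert this using 2
    push_cast; ring

lemma hl_comm (W : ℤ → Submodule ℂ V) (e f : Module.End ℂ V)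
    (he : ∀ i, ∀ v ∈ W i, e v ∈ W (i + 2))
    (hef : ∀ i, ∀ v ∈ W i, e (f v) - f (e v) = (i : ℂ) • v)
    (i : ℤ) (v : V) (hv : v ∈ W i) (n : ℕ) :
    (e ^ (n + 1)) (f v) = f ((e ^ (n + 1)) v) + (((n : ℂ) + 1) * (n + i)) • (e ^ n) v := by
  induction n with
  | zero =>
    have := hef i v hv
    simp only [zero_add, pow_one, pow_zero, Module.End.one_apply, Nat.cast_zero, one_mul]
    rw [← this]; abel
  | succ n ih =>
    have h1 := hef _ _ (hl_pow_mem W e 2 he (n + 1) i v hv)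
    rw [pow_succ', Module.End.mul_apply, ih, map_add, map_smul]
    rw [Module.End.mul_apply e (e ^ (n + 1))]
    rw [sub_eq_iff_eq_add] at h1
    rw [h1, ← Module.End.mul_apply e (e ^ n), ← pow_succ']
    push_cast
    module

lemma hl_inj (W : ℤ → Submodule ℂ V) (e f : Module.End ℂ V)
    (he : ∀ i, ∀ v ∈ W i, e v ∈ W (i + 2))
    (hf : ∀ i, ∀ v ∈ W i, f v ∈ W (i - 2))
    (hef : ∀ i, ∀ v ∈ W i, e (f v) - f (e v) = (i : ℂ) • v) (d : ℕ) :
    ∀ (i : ℤ) (n : ℕ), (n : ℤ) ≤ -i → ∀ v ∈ W i, (e ^ n) v = 0 → (f ^ d) v = 0 → v = 0 := by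
  induction d with
  | zero => intro i n _ v _ _ h; simpa using h
  | succ d ih =>
    intro i n hn v hv hev hfv
    have hfv0 : f v = 0 := by
      apply ih (i - 2) (n + 1) (by push_cast; linarith) (f v) (hf i v hv)
      · rw [hl_comm W e f he hef i v hv n, hev, pow_succ', Module.End.mul_apply, hev]; simp
      · rw [pow_succ, Module.End.mul_apply] at hfv; exact hfv
    clear ih hfv
    induction n with
    | zero => simpa using hev
    | succ n ihn =>
      push_cast at hn
      apply ihn (by linarith)
      have := hl_comm W e f he hef i v hv n
      rw [hfv0, hev, map_zero, map_zero, zero_add, eq_comm, smul_eq_zero] at this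
      rcases this with h | h
      · exfalso
        have h2 : (((n : ℤ) + 1) * (n + i) : ℤ) = 0 := by exact_mod_cast h
        rcases mul_eq_zero.1 h2 with h | h <;> omega
      · exact h

variable [FiniteDimensional ℂ V]

lemma hl_trace_zero (z : Module.End ℂ V)
    (h : ∀ x : Module.End ℂ V, LinearMap.trace ℂ V (z * x) = 0) : z = 0 := by
  ext v
  rw [LinearMap.zero_apply]
  by_contra hne
  obtain ⟨φ, hφ⟩ : ∃ φ : Module.Dual ℂ V, φ (z v) ≠ 0 := by
    by_contra! hc
    exact hne ((Module.forall_dual_apply_eq_zero_iff ℂ (z v)).1 hc)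
  apply hφ
  have h1 := h (LinearMap.toSpanSingleton ℂ V v ∘ₗ φ)
  have h2 : z * (LinearMap.toSpanSingleton ℂ V v ∘ₗ φ) = dualTensorHom ℂ V V (φ ⊗ₜ z v) := by
    ext w; simp [dualTensorHom_apply]
  rw [h2, LinearMap.trace_eq_contract_apply] at h1
  simpa using h1

lemma hl_trace_rep (φ : Module.Dual ℂ (Module.End ℂ V)) :
    ∃ z : Module.End ℂ V, ∀ x, φ x = LinearMap.trace ℂ V (z * x) := by
  let T : Module.End ℂ V →ₗ[ℂ] Module.Dual ℂ (Module.End ℂ V) :=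
    (LinearMap.mul ℂ (Module.End ℂ V)).compr₂ (LinearMap.trace ℂ V)
  have hT : Function.Injective T := by
    rw [injective_iff_map_eq_zero]
    intro z hz
    exact hl_trace_zero z fun x => by
      have := LinearMap.congr_fun hz x
      simpa [T] using this
  have hs : Function.Surjective T :=
    (LinearMap.injective_iff_surjective_of_finrank_eq_finrank
      (Subspace.dual_finrank_eq (K := ℂ) (V := Module.End ℂ V)).symm).1 hT
  obtain ⟨z, hz⟩ := hs φ
  exact ⟨z, fun x => by rw [← hz]; simp [T]⟩

lemma hl_mem_range (e h : Module.End ℂ V)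
    (H : ∀ z : Module.End ℂ V, z * e = e * z → LinearMap.trace ℂ V (z * h) = 0) :
    ∃ f, e * f - f * e = h := by
  let A : Module.End ℂ V →ₗ[ℂ] Module.End ℂ V := LinearMap.mulLeft ℂ e - LinearMap.mulRight ℂ e
  by_contra hc
  have hn : h ∉ LinearMap.range A := by
    rintro ⟨f, hf⟩; exact hc ⟨f, by simpa [A] using hf⟩
  obtain ⟨φ, hφ, hr⟩ := Submodule.exists_le_ker_of_notMem hn
  obtain ⟨z, hz⟩ := hl_trace_rep φ
  apply hφ
  rw [hz]
  apply H
  rw [← sub_eq_zero]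
  apply hl_trace_zero
  intro x
  have h1 : φ (A x) = 0 := hr ⟨x, rfl⟩
  rw [hz] at h1
  simp only [A, LinearMap.sub_apply, LinearMap.mulLeft_apply, LinearMap.mulRight_apply,
    mul_sub, map_sub] at h1
  rw [sub_mul, map_sub, mul_assoc, h1.symm, mul_assoc e z x, LinearMap.trace_mul_comm ℂ e,
    mul_assoc]

lemma hl_proj (W : ℤ → Submodule ℂ V) (hgr : DirectSum.IsInternal W) :
    ∃ c : ∀ i, V →ₗ[ℂ] W i, (∀ i, ∀ v (hv : v ∈ W i), c i v = ⟨v, hv⟩) ∧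
      (∀ i j, i ≠ j → ∀ v ∈ W i, c j v = 0) := by
  let E := LinearEquiv.ofBijective (DirectSum.coeLinearMap W) hgr
  have hE : ∀ i v (hv : v ∈ W i), E.symm v = DirectSum.lof ℂ ℤ (fun i => W i) i ⟨v, hv⟩ := by
    intro i v hv
    rw [LinearEquiv.symm_apply_eq]
    exact (DirectSum.coeLinearMap_lof W i ⟨v, hv⟩).symm
  refine ⟨fun i => DirectSum.component ℂ ℤ (fun i => W i) i ∘ₗ E.symm.toLinearMap, ?_, ?_⟩
  · intro i v hv
    simp [hE i v hv, DirectSum.component.lof_self]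
  · intro i j hij v hv
    simp only [LinearMap.comp_apply, LinearEquiv.coe_coe, hE i v hv, DirectSum.component.of]
    rw [dif_neg hij]

lemma hl_ext (W : ℤ → Submodule ℂ V) (hgr : DirectSum.IsInternal W) (a b : Module.End ℂ V)
    (h : ∀ i, ∀ v ∈ W i, a v = b v) : a = b := by
  ext v
  have hv : v ∈ ⨆ i, W i := by rw [hgr.submodule_iSup_eq_top]; trivial
  induction hv using Submodule.iSup_induction' with
  | mem i x hx => exact h i x hx
  | zero => simp
  | add x y _ _ hx hy => simp [hx, hy]

lemma hl_bdd (W : ℤ → Submodule ℂ V) (hgr : DirectSum.IsInternal W) :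
    ∃ N : ℕ, ∀ i : ℤ, i ∉ Finset.Icc (-(N : ℤ)) N → W i = ⊥ := by
  have hfin : {i | W i ≠ ⊥}.Finite := WellFoundedGT.finite_ne_bot_of_iSupIndep
    hgr.submodule_iSupIndep
  obtain ⟨N, hN⟩ := (hfin.image Int.natAbs).bddAbove
  refine ⟨N, fun i hi => ?_⟩
  by_contra hne
  apply hi
  have : i.natAbs ≤ N := hN ⟨i, hne, rfl⟩
  rw [Finset.mem_Icc]; omega

lemma hl_nilp (W : ℤ → Submodule ℂ V) (hgr : DirectSum.IsInternal W) (f : Module.End ℂ V)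
    (hf : ∀ i, ∀ v ∈ W i, f v ∈ W (i - 2)) : ∃ d : ℕ, f ^ d = 0 := by
  obtain ⟨N, hN⟩ := hl_bdd W hgr
  refine ⟨N + 1, hl_ext W hgr _ _ fun i v hv => ?_⟩
  have h1 := hl_pow_mem W f (-2) (fun i v hv => by simpa [sub_eq_add_neg] using hf i v hv) (N + 1)
    i v hv
  by_cases hi : i ∈ Finset.Icc (-(N : ℤ)) N
  · rw [hN] at h1
    · simpa using h1
    · rw [Finset.mem_Icc] at hi ⊢; push_cast; omega
  · rw [hN i hi] at hv
    rw [(Submodule.mem_bot ℂ).1 hv]; simp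

lemma hl_back (W : ℤ → Submodule ℂ V) (hgr : DirectSum.IsInternal W) (e f : Module.End ℂ V)
    (he : ∀ i, ∀ v ∈ W i, e v ∈ W (i + 2))
    (hf : ∀ i, ∀ v ∈ W i, f v ∈ W (i - 2))
    (hef : ∀ i, ∀ v ∈ W i, e (f v) - f (e v) = (i : ℂ) • v) (k : ℕ) :
      (∀ v ∈ W (-(k : ℤ)), (e ^ k) v = 0 → v = 0) ∧
      (∀ w ∈ W (k : ℤ), ∃ v ∈ W (-(k : ℤ)), (e ^ k) v = w) := by
  obtain ⟨d, hd⟩ := hl_nilp W hgr f hf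
  have hnege : ∃ d, e ^ d = 0 := by
    obtain ⟨N, hN⟩ := hl_bdd W hgr
    refine ⟨N + 1, hl_ext W hgr _ _ fun i v hv => ?_⟩
    have h1 := hl_pow_mem W e 2 he (N + 1) i v hv
    by_cases hi : i ∈ Finset.Icc (-(N : ℤ)) N
    · rw [hN] at h1
      · simpa using h1
      · rw [Finset.mem_Icc] at hi ⊢; push_cast; omega
    · rw [hN i hi] at hv
      rw [(Submodule.mem_bot ℂ).1 hv]; simp
  obtain ⟨d', hd'⟩ := hnege
  have inj1 : ∀ v ∈ W (-(k : ℤ)), (e ^ k) v = 0 → v = 0 := fun v hv h0 =>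
    hl_inj W e f he hf hef d (-(k : ℤ)) k (by simp) v hv h0 (by simp [hd])
  have inj2 : ∀ v ∈ W (k : ℤ), (f ^ k) v = 0 → v = 0 := fun v hv h0 =>
    hl_inj (fun i => W (-i)) f e
      (fun i v hv => by have := hf _ v hv; rwa [show -i - 2 = -(i + 2) by ring] at this)
      (fun i v hv => by have := he _ v hv; rwa [show -i + 2 = -(i - 2) by ring] at this)
      (fun i v hv => by
        have := hef _ v hv
        rw [← neg_sub, this]; push_cast; module) d' (-(k : ℤ)) k (by simp) v (by simpa using hv)
        h0 (by simp [hd'])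
  refine ⟨inj1, ?_⟩
  have m1 : ∀ v ∈ W (-(k : ℤ)), (e ^ k) v ∈ W k := fun v hv => by
    have := hl_pow_mem W e 2 he k _ v hv
    rwa [show -(k : ℤ) + k * 2 = k by ring] at this
  have m2 : ∀ v ∈ W (k : ℤ), (f ^ k) v ∈ W (-(k : ℤ)) := fun v hv => by
    have := hl_pow_mem W f (-2) (fun i v hv => by simpa [sub_eq_add_neg] using hf i v hv) k _ v hv
    rwa [show (k : ℤ) + k * (-2) = -k by ring] at this
  let E := (e ^ k).restrict m1
  let F := (f ^ k).restrict m2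
  have hE : Function.Injective E := by
    rw [injective_iff_map_eq_zero]
    intro a ha
    exact Subtype.ext (inj1 a a.2 (congrArg Subtype.val ha))
  have hF : Function.Injective F := by
    rw [injective_iff_map_eq_zero]
    intro a ha
    exact Subtype.ext (inj2 a a.2 (congrArg Subtype.val ha))
  have hdim := le_antisymm (LinearMap.finrank_le_finrank_of_injective hE)
    (LinearMap.finrank_le_finrank_of_injective hF)
  have hs := (LinearMap.injective_iff_surjective_of_finrank_eq_finrank hdim).1 hE
  intro w hw
  obtain ⟨v, hv⟩ := hs ⟨w, hw⟩
  exact ⟨v, v.2, congrArg Subtype.val hv⟩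

lemma hl_fwd (W : ℤ → Submodule ℂ V) (hgr : DirectSum.IsInternal W) (e h : Module.End ℂ V)
    (he : ∀ i, ∀ v ∈ W i, e v ∈ W (i + 2))
    (hh : ∀ i : ℤ, ∀ v ∈ W i, h v = (i : ℂ) • v)
    (H : ∀ k : ℕ,
      (∀ v ∈ W (-(k : ℤ)), (e ^ k) v = 0 → v = 0) ∧
      (∀ w ∈ W (k : ℤ), ∃ v ∈ W (-(k : ℤ)), (e ^ k) v = w)) :
    ∃ f : Module.End ℂ V, (∀ i, ∀ v ∈ W i, f v ∈ W (i - 2)) ∧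
      (∀ i, ∀ v ∈ W i, e (f v) - f (e v) = (i : ℂ) • v) := by
  obtain ⟨c, hc1, hc2⟩ := hl_proj W hgr
  obtain ⟨N, hN⟩ := hl_bdd W hgr
  let p : ℤ → Module.End ℂ V := fun i => (W i).subtype ∘ₗ c i
  have p1 : ∀ i, ∀ v ∈ W i, p i v = v := fun i v hv => by simp [p, hc1 i v hv]
  have p2 : ∀ i j, i ≠ j → ∀ v ∈ W i, p j v = 0 := fun i j hij v hv => by simp [p, hc2 i j hij v hv]
  have pm : ∀ i v, p i v ∈ W i := fun i v => (c i v).2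
  have hsum : h = ∑ i ∈ Finset.Icc (-(N : ℤ)) N, (i : ℂ) • p i := by
    apply hl_ext W hgr
    intro i v hv
    by_cases hi : i ∈ Finset.Icc (-(N : ℤ)) N
    · rw [hh i v hv, LinearMap.sum_apply, Finset.sum_eq_single_of_mem i hi]
      · simp [p1 i v hv]
      · intro j _ hj
        simp [p2 i j hj.symm v hv]
    · rw [hN i hi] at hv
      rw [(Submodule.mem_bot ℂ).1 hv]; simp
  have htr0 : ∀ z : Module.End ℂ V, z * e = e * z → ∀ k : ℕ,
      LinearMap.trace ℂ V (z * p k) = LinearMap.trace ℂ V (z * p (-(k : ℤ))) := by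
    intro z hz k
    have m1 : ∀ v ∈ W (-(k : ℤ)), (e ^ k) v ∈ W k := fun v hv => by
      have := hl_pow_mem W e 2 he k _ v hv
      rwa [show -(k : ℤ) + k * 2 = k by ring] at this
    let E := LinearEquiv.ofBijective ((e ^ k).restrict m1) (by
      constructor
      · rw [injective_iff_map_eq_zero]
        intro a ha
        exact Subtype.ext ((H k).1 a a.2 (congrArg Subtype.val ha))
      · rintro ⟨w, hw⟩
        obtain ⟨v, hv, h1⟩ := (H k).2 w hw
        exact ⟨⟨v, hv⟩, Subtype.ext h1⟩)
    have hE : ∀ a, ((E a : W k) : V) = (e ^ k) a := fun a => rfl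
    let G : Module.End ℂ V := (W (-(k : ℤ))).subtype ∘ₗ E.symm.toLinearMap ∘ₗ c k
    have g1 : e ^ k * G = p k := by
      ext v
      simp [G, p, ← hE]
    have g2 : G * e ^ k = p (-(k : ℤ)) := by
      apply hl_ext W hgr
      intro i v hv
      rw [Module.End.mul_apply]
      by_cases hi : i = -(k : ℤ)
      · subst hi
        rw [p1 _ v hv]
        have : c k ((e ^ k) v) = E ⟨v, hv⟩ := by
          rw [hc1 k _ (m1 v hv)]; rfl
        simp [G, this]
      · rw [p2 i _ hi v hv]
        have := hc2 (i + k * 2) k (by omega) _ (hl_pow_mem W e 2 he k i v hv)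
        simp [G, this]
    have hzk : z * e ^ k = e ^ k * z := (Commute.pow_right (show Commute z e from hz) k).eq
    rw [← g1, ← g2, ← mul_assoc, hzk, mul_assoc, LinearMap.trace_mul_comm, mul_assoc]
  have htr : ∀ z : Module.End ℂ V, z * e = e * z → LinearMap.trace ℂ V (z * h) = 0 := by
    intro z hz
    have hsym : ∀ i : ℤ, LinearMap.trace ℂ V (z * p i) = LinearMap.trace ℂ V (z * p (-i)) := by
      intro i
      obtain ⟨k, rfl | rfl⟩ := i.eq_nat_or_neg
      · exact htr0 z hz k
      · rw [neg_neg]; exact (htr0 z hz k).symm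
    rw [hsum, Finset.mul_sum, map_sum]
    simp only [mul_smul_comm, map_smul, smul_eq_mul]
    have hs : ∑ i ∈ Finset.Icc (-(N : ℤ)) N, (i : ℂ) * LinearMap.trace ℂ V (z * p i) =
        ∑ i ∈ Finset.Icc (-(N : ℤ)) N, -((i : ℂ) * LinearMap.trace ℂ V (z * p i)) := by
      apply Finset.sum_nbij' (fun i => -i) (fun i => -i)
      · intro a ha; rw [Finset.mem_Icc] at ha ⊢; omega
      · intro a ha; rw [Finset.mem_Icc] at ha ⊢; omega
      · simp
      · simp
      · intro a _
        rw [← hsym a]; push_cast; ring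
    rw [Finset.sum_neg_distrib] at hs
    exact self_eq_neg.1 hs
  obtain ⟨g, hg⟩ := hl_mem_range e h htr
  have pe : ∀ i v, e (p i v) = p (i + 2) (e v) := by
    intro i v
    have : e * p i = p (i + 2) * e := by
      apply hl_ext W hgr
      intro j v hv
      simp only [Module.End.mul_apply]
      by_cases hj : j = i
      · subst hj
        rw [p1 _ v hv, p1 _ _ (he _ v hv)]
      · rw [p2 j i hj v hv, p2 (j + 2) (i + 2) (by omega) _ (he _ v hv), map_zero]
    exact LinearMap.congr_fun this v
  let f : Module.End ℂ V := ∑ i ∈ Finset.Icc (-(N : ℤ)) N, p (i - 2) * g * p i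
  have hf : ∀ i, ∀ v ∈ W i, f v = p (i - 2) (g v) := by
    intro i v hv
    by_cases hi : i ∈ Finset.Icc (-(N : ℤ)) N
    · simp only [f]
      rw [LinearMap.sum_apply, Finset.sum_eq_single_of_mem i hi]
      · simp [p1 i v hv]
      · intro j _ hj
        simp [p2 i j hj.symm v hv]
    · rw [hN i hi] at hv
      rw [(Submodule.mem_bot ℂ).1 hv]; simp
  refine ⟨f, fun i v hv => by rw [hf i v hv]; exact pm _ _, fun i v hv => ?_⟩
  rw [hf i v hv, hf _ _ (he i v hv), pe, sub_add_cancel, add_sub_cancel_right, ← map_sub]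
  have h1 : e (g v) - g (e v) = h v := by rw [← hg]; rfl
  rw [h1, hh i v hv, map_smul, p1 i v hv]

end HL

/-- For a finite-dimensional ℤ-graded complex vector space `V` with grading operator `h`
and an endomorphism `e` of degree `2`, the following are equivalent:
(a) `e^k` restricts to an isomorphism `V_{-k} → V_k` for every `k ≥ 0`;
(b) `e` can be completed, by an endomorphism `f` of degree `−2`, to an sl₂-triple
`(e, f, h)`. -/
theorem hard_lefschetz_iff_sl2
    (V : Type) [AddCommGroup V] [Module ℂ V] [FiniteDimensional ℂ V]
    (Vsub : ℤ → Submodule ℂ V) (hgr : DirectSum.IsInternal Vsub)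
    (e h : Module.End ℂ V)
    (he : ∀ i : ℤ, (Vsub i).map e ≤ Vsub (i + 2))
    (hh : ∀ i : ℤ, ∀ v ∈ Vsub i, h v = i • v) :
    (∀ k : ℕ,
      (∀ v ∈ Vsub (-(k : ℤ)), (e ^ k) v = 0 → v = 0) ∧
      (∀ w ∈ Vsub (k : ℤ), ∃ v ∈ Vsub (-(k : ℤ)), (e ^ k) v = w)) ↔
    (∃ f : Module.End ℂ V,
      (∀ i : ℤ, (Vsub i).map f ≤ Vsub (i - 2)) ∧
      ⁅h, e⁆ = 2 • e ∧ ⁅h, f⁆ = -(2 • f) ∧ ⁅e, f⁆ = h) := by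
  have he' : ∀ i, ∀ v ∈ Vsub i, e v ∈ Vsub (i + 2) := fun i v hv =>
    he i (Submodule.mem_map_of_mem hv)
  have hh' : ∀ i : ℤ, ∀ v ∈ Vsub i, h v = (i : ℂ) • v := fun i v hv => by
    rw [hh i v hv, Int.cast_smul_eq_zsmul]
  constructor
  · intro H
    obtain ⟨f, hf, hef⟩ := hl_fwd Vsub hgr e h he' hh' H
    refine ⟨f, ?_, ?_, ?_, ?_⟩
    · rintro i _ ⟨v, hv, rfl⟩
      exact hf i v hv
    · apply hl_ext Vsub hgr
      intro i v hv
      simp only [Ring.lie_def, LinearMap.sub_apply, Module.End.mul_apply, LinearMap.smul_apply]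
      rw [hh' _ _ (he' i v hv), hh' i v hv, map_smul]
      push_cast
      module
    · apply hl_ext Vsub hgr
      intro i v hv
      simp only [Ring.lie_def, LinearMap.sub_apply, Module.End.mul_apply, LinearMap.smul_apply,
        LinearMap.neg_apply]
      rw [hh' _ _ (hf i v hv), hh' i v hv, map_smul]
      push_cast
      module
    · apply hl_ext Vsub hgr
      intro i v hv
      simp only [Ring.lie_def, LinearMap.sub_apply, Module.End.mul_apply]
      rw [hef i v hv, hh' i v hv]
  · rintro ⟨f, hf, -, -, hef⟩ k
    apply hl_back Vsub hgr e f he' (fun i v hv => hf i (Submodule.mem_map_of_mem hv))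
    intro i v hv
    rw [← hh' i v hv, ← hef]
    rfl
end

section
/- Let U and V be Lefschetz structures and let φ : U → V be a map of Lefschetz structures. Then for every i ∈ ℤ the natural map (ker φ ∩ P_i U)/(ker φ ∩ P_{i-1} U) → ker( P_i U/P_{i-1} U → P_i V/P_{i-1} V ) (induced by the inclusion ker φ ∩ P_i U ⊆ P_i U) is an isomorphism. Consequently ker φ, equipped with the restricted endomorphism ω_U and the induced filtration (ker φ ∩ P_i U)_i, is again a Lefschetz structure. -/
/-- A Lefschetz structure on a (finite-dimensional) complex vector space `V`:
an endomorphism `ω` together with a finite increasing filtration `P` such that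
`ω(P_i) ⊆ P_{i+2}` and `ω^k` induces an isomorphism `P_{-k}/P_{-k-1} → P_k/P_{k-1}`
for all `k ≥ 0` (the last condition is expressed elementwise). -/
def IsLefschetz {V : Type} [AddCommGroup V] [Module ℂ V]
    (ω : Module.End ℂ V) (P : ℤ → Submodule ℂ V) : Prop :=
  Monotone P ∧ (∃ i, P i = ⊥) ∧ (∃ i, P i = ⊤) ∧
  (∀ i : ℤ, (P i).map ω ≤ P (i + 2)) ∧
  (∀ k : ℕ,
    -- injectivity of the induced map P_{-k}/P_{-k-1} → P_k/P_{k-1}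
    (∀ v ∈ P (-(k : ℤ)), (ω ^ k) v ∈ P ((k : ℤ) - 1) → v ∈ P (-(k : ℤ) - 1)) ∧
    -- surjectivity of the induced map P_{-k}/P_{-k-1} → P_k/P_{k-1}
    (∀ w ∈ P (k : ℤ), ∃ v ∈ P (-(k : ℤ)), (ω ^ k) v - w ∈ P ((k : ℤ) - 1)))

theorem lef_pow_mem {V : Type} [AddCommGroup V] [Module ℂ V]
    {ω : Module.End ℂ V} {P : ℤ → Submodule ℂ V} (h : IsLefschetz ω P) (m : ℕ) :
    ∀ (i j : ℤ) (v : V), v ∈ P i → i + 2 * m ≤ j → (ω ^ m) v ∈ P j := by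
  induction m with
  | zero =>
    intro i j v hv hij
    simpa using h.1 (by simpa using hij) hv
  | succ m ih =>
    intro i j v hv hij
    rw [pow_succ', Module.End.mul_apply]
    have h1 := ih i (j - 2) v hv (by push_cast at hij; linarith)
    have h2 := h.2.2.2.1 (j - 2) (Submodule.mem_map_of_mem h1)
    simpa using h2

theorem lef_eventually_bot {V : Type} [AddCommGroup V] [Module ℂ V]
    {ω : Module.End ℂ V} {P : ℤ → Submodule ℂ V} (h : IsLefschetz ω P) :
    ∃ N : ℕ, ∀ i : ℤ, i ≤ -(N : ℤ) → ∀ v ∈ P i, v = 0 := by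
  obtain ⟨i₀, hi₀⟩ := h.2.1
  refine ⟨i₀.natAbs, fun i hi v hv => ?_⟩
  have : v ∈ P i₀ := h.1 (by omega) hv
  simpa [hi₀] using this

/-- Partial Deligne lift of a primitive class. -/
theorem lef_lift {V : Type} [AddCommGroup V] [Module ℂ V]
    {ω : Module.End ℂ V} {P : ℤ → Submodule ℂ V} (h : IsLefschetz ω P) (k : ℕ) (v : V)
    (hv : v ∈ P (-(k : ℤ))) (hp : (ω ^ (k + 1)) v ∈ P ((k : ℤ) + 1)) (n : ℕ) :
    ∃ d ∈ P (-(k : ℤ)), v - d ∈ P (-(k : ℤ) - 1) ∧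
      ∀ m : ℕ, k < m → m ≤ k + n → (ω ^ m) d ∈ P ((m : ℤ) - 1) := by
  suffices H : ∃ d ∈ P (-(k : ℤ)), v - d ∈ P (-(k : ℤ) - 1) ∧
      (ω ^ (k + n + 1)) d ∈ P ((k + n + 1 : ℕ) : ℤ) ∧
      ∀ m : ℕ, k < m → m ≤ k + n → (ω ^ m) d ∈ P ((m : ℤ) - 1) by
    obtain ⟨d, h1, h2, _, h3⟩ := H
    exact ⟨d, h1, h2, h3⟩
  induction n with
  | zero =>
    refine ⟨v, hv, by simp, by simpa using hp, fun m h1 h2 => by omega⟩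
  | succ n ih =>
    obtain ⟨d, hd, hvd, htop, hall⟩ := ih
    obtain ⟨w, hw, hwd⟩ := (h.2.2.2.2 (k + n + 1)).2 _ htop
    have hnew : (ω ^ (k + n + 1)) (d - w) ∈ P (((k + n + 1 : ℕ) : ℤ) - 1) := by
      have := Submodule.neg_mem _ hwd
      rwa [neg_sub, ← map_sub] at this
    refine ⟨d - w, Submodule.sub_mem _ hd (h.1 (by push_cast; omega) hw), ?_, ?_, ?_⟩
    · have : v - (d - w) = (v - d) + w := by abel
      rw [this]
      exact Submodule.add_mem _ hvd (h.1 (by push_cast; omega) hw)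
    · have e : k + (n + 1) + 1 = 1 + (k + n + 1) := by omega
      rw [e, pow_add, Module.End.mul_apply]
      exact lef_pow_mem h 1 _ _ _ hnew (by push_cast; omega)
    · intro m h1 h2
      by_cases hm : m = k + n + 1
      · subst hm; exact hnew
      · rw [map_sub]
        exact Submodule.sub_mem _ (hall m h1 (by omega))
          (lef_pow_mem h m _ _ _ hw (by push_cast; omega))

theorem lef_lift_unique {V : Type} [AddCommGroup V] [Module ℂ V]
    {ω : Module.End ℂ V} {P : ℤ → Submodule ℂ V} (h : IsLefschetz ω P) (k : ℕ) (d : V)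
    (hd : d ∈ P (-(k : ℤ) - 1)) (n : ℕ)
    (hall : ∀ m : ℕ, k < m → m ≤ k + n → (ω ^ m) d ∈ P ((m : ℤ) - 1)) :
    d ∈ P (-((k + n : ℕ) : ℤ) - 1) := by
  induction n with
  | zero => simpa using hd
  | succ n ih =>
    have h1 := ih (fun m a b => hall m a (by omega))
    have h2 := hall (k + n + 1) (by omega) (by omega)
    exact (h.2.2.2.2 (k + n + 1)).1 d (h.1 (by push_cast; omega) h1) h2

theorem lef_pow_comm {U V : Type} [AddCommGroup U] [Module ℂ U] [AddCommGroup V] [Module ℂ V]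
    {ωU : Module.End ℂ U} {ωV : Module.End ℂ V} {φ : U →ₗ[ℂ] V}
    (hφω : φ ∘ₗ ωU = ωV ∘ₗ φ) (m : ℕ) (u : U) : φ ((ωU ^ m) u) = (ωV ^ m) (φ u) := by
  induction m with
  | zero => simp
  | succ m ih =>
    rw [pow_succ', pow_succ', Module.End.mul_apply, Module.End.mul_apply, ← ih]
    exact LinearMap.congr_fun hφω _

theorem lef_strict_neg {U V : Type} [AddCommGroup U] [Module ℂ U] [AddCommGroup V] [Module ℂ V]
    {ωU : Module.End ℂ U} {P : ℤ → Submodule ℂ U} (hU : IsLefschetz ωU P)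
    {ωV : Module.End ℂ V} {Q : ℤ → Submodule ℂ V} (hV : IsLefschetz ωV Q)
    {φ : U →ₗ[ℂ] V} (hφP : ∀ i : ℤ, ∀ u ∈ P i, φ u ∈ Q i)
    (hφω : φ ∘ₗ ωU = ωV ∘ₗ φ) (k : ℕ) (v : U) (hv : v ∈ P (-(k : ℤ)))
    (hφv : φ v ∈ Q (-(k : ℤ) - 1)) :
    ∃ u, φ u = 0 ∧ u ∈ P (-(k : ℤ)) ∧ v - u ∈ P (-(k : ℤ) - 1) := by
  obtain ⟨N, hN⟩ := lef_eventually_bot hU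
  obtain ⟨M, hM⟩ := lef_eventually_bot hV
  suffices H : ∀ n k : ℕ, N ≤ k + n → ∀ v ∈ P (-(k : ℤ)), φ v ∈ Q (-(k : ℤ) - 1) →
      ∃ u, φ u = 0 ∧ u ∈ P (-(k : ℤ)) ∧ v - u ∈ P (-(k : ℤ) - 1) from
    H N k (by omega) v hv hφv
  clear hv hφv v k
  intro n
  induction n with
  | zero =>
    intro k hk v hv _
    have := hN _ (by omega) v hv
    subst this
    exact ⟨0, by simp, by simp, by simp⟩
  | succ n ih =>
    intro k hk v hv hφv
    obtain ⟨w, hw, hwv⟩ := (hU.2.2.2.2 (k + 2)).2 ((ωU ^ (k + 1)) v)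
      (lef_pow_mem hU _ _ _ _ hv (by push_cast; omega))
    have hφw : φ w ∈ Q (-((k + 2 : ℕ) : ℤ) - 1) := by
      refine (hV.2.2.2.2 (k + 2)).1 _ (hφP _ _ hw) ?_
      have h1 := hφP _ _ hwv
      rw [map_sub, lef_pow_comm hφω, lef_pow_comm hφω] at h1
      have h2 := lef_pow_mem hV (k + 1) _ (((k + 2 : ℕ) : ℤ) - 1) _ hφv (by push_cast; omega)
      simpa using Submodule.add_mem _ h1 h2
    obtain ⟨u', hu'0, hu', hwu'⟩ := ih (k + 2) (by omega) w hw hφw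
    -- the primitive part
    have hωu : ωU u' ∈ P (-(k : ℤ)) := by
      simpa using lef_pow_mem hU 1 _ (-(k : ℤ)) _ hu' (by push_cast; omega)
    have hωw : ωU w ∈ P (-(k : ℤ)) := by
      simpa using lef_pow_mem hU 1 _ (-(k : ℤ)) _ hw (by push_cast; omega)
    have hωd : ωU (w - u') ∈ P (-(k : ℤ) - 1) := by
      simpa only [pow_one] using lef_pow_mem hU 1 _ (-(k : ℤ) - 1) _ hwu' (by push_cast; omega)
    have hφωw : φ (ωU w) ∈ Q (-(k : ℤ) - 1) := by
      have h1 := lef_pow_mem hV 1 _ (-(k : ℤ) - 1) _ hφw (by push_cast; omega)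
      rw [← lef_pow_comm hφω] at h1
      simpa using h1
    have hprim : (ωU ^ (k + 1)) (v - ωU w) ∈ P ((k : ℤ) + 1) := by
      have h1 := Submodule.neg_mem _ hwv
      have e : (ωU ^ (k + 2)) w = (ωU ^ (k + 1)) (ωU w) := by
        rw [pow_succ, Module.End.mul_apply]
      rw [neg_sub, e, ← map_sub] at h1
      exact hU.1 (by push_cast; omega) h1
    obtain ⟨d, hd, hvd, hall⟩ := lef_lift hU k (v - ωU w) (Submodule.sub_mem _ hv hωw) hprim M
    have hφd : φ d ∈ Q (-(k : ℤ) - 1) := by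
      have h1 := hφP _ _ hvd
      rw [map_sub, map_sub] at h1
      have h2 := Submodule.sub_mem _ (Submodule.sub_mem _ hφv hφωw) h1
      simpa using h2
    have hd0 : φ d = 0 := by
      refine hM _ ?_ _ (lef_lift_unique hV k (φ d) hφd M (fun m a b => ?_))
      · push_cast; omega
      · rw [← lef_pow_comm hφω]
        exact hφP _ _ (hall m a b)
    have hωu0 : φ (ωU u') = 0 := by
      have := lef_pow_comm hφω 1 u'
      simpa [hu'0] using this
    refine ⟨d + ωU u', by rw [map_add, hd0, hωu0, add_zero], Submodule.add_mem _ hd hωu, ?_⟩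
    have e : v - (d + ωU u') = (v - ωU w - d) + ωU (w - u') := by
      rw [map_sub]; abel
    rw [e]
    exact Submodule.add_mem _ hvd hωd

/-- For a map `φ : U → V` of Lefschetz structures: (1) the natural map
`(ker φ ∩ P_i U)/(ker φ ∩ P_{i-1} U) → ker(P_i U/P_{i-1} U → P_i V/P_{i-1} V)` is an
isomorphism (stated elementwise: it is surjective; injectivity holds by definition), and
(2) `ker φ`, with the restricted endomorphism and induced filtration, is again a
Lefschetz structure. -/
theorem lefschetz_kernel
    (U : Type) [AddCommGroup U] [Module ℂ U] [FiniteDimensional ℂ U]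
    (V : Type) [AddCommGroup V] [Module ℂ V] [FiniteDimensional ℂ V]
    (ωU : Module.End ℂ U) (P : ℤ → Submodule ℂ U) (hU : IsLefschetz ωU P)
    (ωV : Module.End ℂ V) (Q : ℤ → Submodule ℂ V) (hV : IsLefschetz ωV Q)
    (φ : U →ₗ[ℂ] V)
    (hφP : ∀ i : ℤ, (P i).map φ ≤ Q i)
    (hφω : φ ∘ₗ ωU = ωV ∘ₗ φ) :
    -- (1): surjectivity of Gr(ker φ) → ker(Gr φ) in each degree
    (∀ i : ℤ, ∀ v ∈ P i, φ v ∈ Q (i - 1) →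
      ∃ u, φ u = 0 ∧ u ∈ P i ∧ v - u ∈ P (i - 1)) ∧
    -- (2): ker φ is a Lefschetz structure
    (∃ hker : ∀ x ∈ LinearMap.ker φ, ωU x ∈ LinearMap.ker φ,
      IsLefschetz (ωU.restrict hker)
        (fun i => (P i).comap (LinearMap.ker φ).subtype)) := by
  have hP : ∀ i : ℤ, ∀ u ∈ P i, φ u ∈ Q i := fun i u hu =>
    hφP i (Submodule.mem_map_of_mem hu)
  have key : ∀ (k : ℕ) (w : U), w ∈ P (k : ℤ) → φ w ∈ Q ((k : ℤ) - 1) →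
      ∃ u ∈ P (-(k : ℤ)), φ u = 0 ∧ (ωU ^ k) u - w ∈ P ((k : ℤ) - 1) := by
    intro k w hw hφw
    obtain ⟨v, hv, hvw⟩ := (hU.2.2.2.2 k).2 w hw
    have hφv : φ v ∈ Q (-(k : ℤ) - 1) := by
      refine (hV.2.2.2.2 k).1 _ (hP _ _ hv) ?_
      have h1 := hP _ _ hvw
      rw [map_sub, lef_pow_comm hφω] at h1
      simpa using Submodule.add_mem _ h1 hφw
    obtain ⟨u, hu0, hu, hvu⟩ := lef_strict_neg hU hV hP hφω k v hv hφv
    refine ⟨u, hu, hu0, ?_⟩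
    have h1 := lef_pow_mem hU k _ ((k : ℤ) - 1) _ hvu (by omega)
    have h2 := Submodule.sub_mem _ hvw h1
    have e : (ωU ^ k) u - w = (ωU ^ k) v - w - (ωU ^ k) (v - u) := by
      rw [map_sub]; abel
    rwa [e]
  refine ⟨?_, ?_⟩
  · intro i v hv hφv
    rcases Int.eq_nat_or_neg i with ⟨k, rfl | rfl⟩
    · obtain ⟨u, hu, hu0, huv⟩ := key k v hv hφv
      refine ⟨(ωU ^ k) u, by rw [lef_pow_comm hφω, hu0, map_zero],
        lef_pow_mem hU k _ _ _ hu (by omega), ?_⟩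
      have := Submodule.neg_mem _ huv
      rwa [neg_sub] at this
    · exact lef_strict_neg hU hV hP hφω k v hv hφv
  · have hker : ∀ x ∈ LinearMap.ker φ, ωU x ∈ LinearMap.ker φ := by
      intro x hx
      rw [LinearMap.mem_ker] at hx ⊢
      have := lef_pow_comm hφω 1 x
      simpa [hx] using this
    have hpow : ∀ (k : ℕ) (x : LinearMap.ker φ),
        (((ωU.restrict hker) ^ k) x : U) = (ωU ^ k) (x : U) := by
      intro k x
      induction k with
      | zero => simp
      | succ k ih =>
        rw [pow_succ', pow_succ', Module.End.mul_apply, Module.End.mul_apply, ← ih]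
        rfl
    refine ⟨hker, ?_, ?_, ?_, ?_, ?_⟩
    · intro i j hij x hx
      exact hU.1 hij hx
    · obtain ⟨i, hi⟩ := hU.2.1
      refine ⟨i, ?_⟩
      simp [hi]
    · obtain ⟨i, hi⟩ := hU.2.2.1
      refine ⟨i, ?_⟩
      simp [hi]
    · rintro i _ ⟨x, hx, rfl⟩
      exact hU.2.2.2.1 i (Submodule.mem_map_of_mem hx)
    · intro k
      refine ⟨?_, ?_⟩
      · intro v hv hvk
        refine (hU.2.2.2.2 k).1 (v : U) hv ?_
        rw [← hpow]
        exact hvk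
      · intro w hw
        have hw0 : φ (w : U) = 0 := w.2
        obtain ⟨u, hu, hu0, huw⟩ := key k w hw (by rw [hw0]; exact Submodule.zero_mem _)
        refine ⟨⟨u, hu0⟩, hu, ?_⟩
        rw [Submodule.mem_comap, map_sub, Submodule.subtype_apply, Submodule.subtype_apply, hpow]
        exact huw
end

section
/- Let U and V be Lefschetz structures and let φ : U → V be a map of Lefschetz structures. Then φ is strictly compatible with the filtrations: for every i ∈ ℤ, φ(P_i U) = φ(U) ∩ P_i V. Equivalently, if u ∈ U satisfies φ(u) ∈ P_i V, then there exists u' ∈ P_i U with φ(u') = φ(u). -/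
theorem lef_pow {V : Type} [AddCommGroup V] [Module ℂ V]
    {ω : Module.End ℂ V} {P : ℤ → Submodule ℂ V} (h : IsLefschetz ω P)
    (n : ℕ) : ∀ (i j : ℤ) (v : V), v ∈ P i → i + 2 * n ≤ j → (ω ^ n) v ∈ P j := by
  induction n with
  | zero => intro i j v hv hj; exact h.1 (by simpa using hj) (by simpa using hv)
  | succ n ih =>
    intro i j v hv hj
    rw [pow_succ, Module.End.mul_apply]
    refine ih (i + 2) j _ (h.2.2.2.1 i ⟨v, hv, rfl⟩) ?_
    push_cast at hj
    linarith

theorem lef_prim {V : Type} [AddCommGroup V] [Module ℂ V]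
    {ω : Module.End ℂ V} {P : ℤ → Submodule ℂ V} (h : IsLefschetz ω P)
    (k : ℕ) (v : V) (hv1 : (ω ^ (k + 1)) v ∈ P (k + 1)) :
    ∃ a, a - v ∈ P (-k - 1) ∧ ∀ s : ℕ, k < s → (ω ^ s) a ∈ P (s - 1) := by
  have key : ∀ m : ℕ, ∃ a, a - v ∈ P (-k - 1) ∧
      (∀ s : ℕ, k < s → s ≤ k + m → (ω ^ s) a ∈ P (s - 1)) ∧
      (ω ^ (k + m + 1)) a ∈ P (k + m + 1) := by
    intro m
    induction m with
    | zero => exact ⟨v, by simp, fun s h1 h2 => by omega, by simpa using hv1⟩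
    | succ m ih =>
      obtain ⟨a, ha, hs, hl⟩ := ih
      obtain ⟨c, hc, hc2⟩ := (h.2.2.2.2 (k + m + 1)).2 _ (by push_cast; exact hl)
      push_cast at hc hc2
      have hl' : (ω ^ (k + m + 1)) (a - c) ∈ P (k + m) := by
        rw [map_sub, ← neg_sub]
        exact neg_mem (h.1 (by linarith) hc2)
      refine ⟨a - c, ?_, ?_, ?_⟩
      · have : a - c - v = (a - v) - c := by abel
        rw [this]
        exact sub_mem ha (h.1 (by linarith) hc)
      · intro s h1 h2
        by_cases h3 : s ≤ k + m
        · rw [map_sub]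
          refine sub_mem (hs s h1 h3) (lef_pow h s _ _ _ hc (by have : (s : ℤ) ≤ k + m := by exact_mod_cast h3
                                                                linarith))
        · obtain rfl : s = k + m + 1 := by omega
          exact h.1 (by push_cast; linarith) hl'
      · have e : k + (m + 1) + 1 = 1 + (k + m + 1) := by omega
        rw [e, pow_add, Module.End.mul_apply]
        exact lef_pow h 1 _ _ _ hl' (by push_cast; linarith)
  obtain ⟨t, ht⟩ := h.2.2.1
  obtain ⟨a, ha, hs, -⟩ := key (t.toNat + 1)
  refine ⟨a, ha, fun s h1 => ?_⟩
  by_cases h2 : s ≤ k + (t.toNat + 1)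
  · exact hs s h1 h2
  · exact h.1 (show t ≤ _ by omega) (by rw [ht]; trivial)

theorem lef_uniq {V : Type} [AddCommGroup V] [Module ℂ V]
    {ω : Module.End ℂ V} {P : ℤ → Submodule ℂ V} (h : IsLefschetz ω P)
    (k : ℕ) (a : V) (ha : a ∈ P (-k - 1))
    (hs : ∀ s : ℕ, k < s → (ω ^ s) a ∈ P (s - 1)) : a = 0 := by
  have key : ∀ m : ℕ, a ∈ P (-k - 1 - m) := by
    intro m
    induction m with
    | zero => simpa using ha
    | succ m ih =>
      have := (h.2.2.2.2 (k + 1 + m)).1 a (h.1 (by push_cast; linarith) ih) (hs _ (by omega))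
      exact h.1 (by push_cast; linarith) this
  obtain ⟨b, hb⟩ := h.2.1
  have := h.1 (show _ ≤ b by omega) (key (-b).toNat)
  rw [hb] at this
  simpa using this

theorem lef_lift_s12 {U V : Type} [AddCommGroup U] [Module ℂ U] [AddCommGroup V] [Module ℂ V]
    {ωU : Module.End ℂ U} {P : ℤ → Submodule ℂ U} (hU : IsLefschetz ωU P)
    {ωV : Module.End ℂ V} {Q : ℤ → Submodule ℂ V} (hV : IsLefschetz ωV Q)
    (φ : U →ₗ[ℂ] V)
    (hφP : ∀ i : ℤ, ∀ u ∈ P i, φ u ∈ Q i)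
    (hφω : ∀ n : ℕ, ∀ u, φ ((ωU ^ n) u) = (ωV ^ n) (φ u)) :
    ∀ k : ℕ, ∀ v ∈ P (-k), ∃ v', v' - v ∈ P (-k - 1) ∧ (φ v' ∈ Q (-k - 1) → φ v' = 0) := by
  obtain ⟨b, hb⟩ := hU.2.1
  have key : ∀ m k : ℕ, -b ≤ k + m → ∀ v ∈ P (-k), ∃ v', v' - v ∈ P (-k - 1) ∧
      (φ v' ∈ Q (-k - 1) → φ v' = 0) := by
    intro m
    induction m with
    | zero =>
      intro k hk v hv
      have := hU.1 (show _ ≤ b by push_cast at hk; linarith) hv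
      rw [hb] at this
      obtain rfl : v = 0 := by simpa using this
      exact ⟨0, by simp, by simp⟩
    | succ m ih =>
      intro k hk v hv
      obtain ⟨w, hw, hw2⟩ := (hU.2.2.2.2 (k + 2)).2 ((ωU ^ (k + 1)) v)
        (lef_pow hU _ _ _ _ hv (by push_cast; linarith))
      obtain ⟨w', hw', hz⟩ := ih (k + 2) (by push_cast at hk ⊢; linarith) w hw
      push_cast at hw hw2 hw' hz
      have hw'm : w' ∈ P (-(k + 2)) := by
        have := add_mem (hU.1 (show _ ≤ -((k : ℤ) + 2) by linarith) hw') hw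
        simpa using this
      have e2 : ∀ x : U, (ωU ^ (k + 1)) (ωU x) = (ωU ^ (k + 2)) x := fun x => by
        rw [← Module.End.mul_apply, ← pow_succ]
      have e3 : ∀ x : V, (ωV ^ (k + 1)) (ωV x) = (ωV ^ (k + 2)) x := fun x => by
        rw [← Module.End.mul_apply, ← pow_succ]
      obtain ⟨a, ha, has⟩ := lef_prim hU k (v - ωU w') (by
        have : (ωU ^ (k + 1)) (v - ωU w') = -((ωU ^ (k + 2)) w - (ωU ^ (k + 1)) v)
            - (ωU ^ (k + 2)) (w' - w) := by
          rw [map_sub, e2, map_sub]; abel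
        rw [this]
        refine sub_mem (neg_mem (hU.1 (by linarith) hw2)) (lef_pow hU _ _ _ _ hw' ?_)
        push_cast; linarith)
      have h1 := hφω 1
      simp only [pow_one] at h1
      refine ⟨a + ωU w', ?_, ?_⟩
      · have : a + ωU w' - v = a - (v - ωU w') := by abel
        rwa [this]
      · intro hq
        have hφs : ∀ s : ℕ, k < s → (ωV ^ s) (φ a) ∈ Q (s - 1) := fun s hs => by
          rw [← hφω]; exact hφP _ _ (has s hs)
        have hw0 : φ w' = 0 := by
          apply hz
          have := (hV.2.2.2.2 (k + 2)).1 (φ w') (by push_cast; exact hφP _ _ hw'm) (by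
            have e : (ωV ^ (k + 2)) (φ w') = (ωV ^ (k + 1)) (φ (a + ωU w'))
              - (ωV ^ (k + 1)) (φ a) := by
              rw [← map_sub, ← e3, map_add, h1]; congr 1; abel
            rw [e]
            refine sub_mem (lef_pow hV _ _ _ _ hq (by push_cast; linarith)) ?_
            exact hV.1 (by push_cast; linarith) (hφs (k + 1) (by omega)))
          push_cast at this
          exact this
        rw [map_add, h1, hw0, map_zero, add_zero] at hq ⊢
        exact lef_uniq hV k _ hq hφs
  intro k
  exact key (-b).toNat k (by omega)

/-- A map of Lefschetz structures is strictly compatible with the filtrations: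
`φ(P_i U) = φ(U) ∩ P_i V`; equivalently, if `φ(u) ∈ P_i V` then `φ(u) = φ(u')` for
some `u' ∈ P_i U`. -/
theorem lefschetz_strictness
    (U : Type) [AddCommGroup U] [Module ℂ U] [FiniteDimensional ℂ U]
    (V : Type) [AddCommGroup V] [Module ℂ V] [FiniteDimensional ℂ V]
    (ωU : Module.End ℂ U) (P : ℤ → Submodule ℂ U) (hU : IsLefschetz ωU P)
    (ωV : Module.End ℂ V) (Q : ℤ → Submodule ℂ V) (hV : IsLefschetz ωV Q)
    (φ : U →ₗ[ℂ] V)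
    (hφP : ∀ i : ℤ, (P i).map φ ≤ Q i)
    (hφω : φ ∘ₗ ωU = ωV ∘ₗ φ) :
    (∀ i : ℤ, (P i).map φ = LinearMap.range φ ⊓ Q i) ∧
    (∀ i : ℤ, ∀ u : U, φ u ∈ Q i → ∃ u' ∈ P i, φ u' = φ u) := by
  have hP : ∀ i : ℤ, ∀ u ∈ P i, φ u ∈ Q i := fun i u hu => hφP i ⟨u, hu, rfl⟩
  have h1 : ∀ u, φ (ωU u) = ωV (φ u) := fun u => LinearMap.congr_fun hφω u
  have hn : ∀ n : ℕ, ∀ u, φ ((ωU ^ n) u) = (ωV ^ n) (φ u) := by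
    intro n
    induction n with
    | zero => intro u; simp
    | succ n ih => intro u; rw [pow_succ, pow_succ, Module.End.mul_apply, Module.End.mul_apply, ih, h1]
  have lift := lef_lift_s12 hU hV φ hP hn
  have step : ∀ n : ℤ, ∀ u ∈ P n, φ u ∈ Q (n - 1) → ∃ u' ∈ P (n - 1), φ u' = φ u := by
    intro n u hu hq
    rcases Int.eq_nat_or_neg n with ⟨k, rfl | rfl⟩
    · obtain ⟨v, hv, hvu⟩ := (hU.2.2.2.2 k).2 u hu
      obtain ⟨v', hv', hz⟩ := lift k v hv
      have hm : (ωU ^ k) v' - u ∈ P (k - 1) := by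
        have e : (ωU ^ k) v' - u = (ωU ^ k) (v' - v) + ((ωU ^ k) v - u) := by
          rw [map_sub]; abel
        rw [e]
        exact add_mem (lef_pow hU _ _ _ _ hv' (by linarith)) hvu
      have hv'm : v' ∈ P (-k) := by
        have := add_mem (hU.1 (show _ ≤ -(k : ℤ) by linarith) hv') hv
        simpa using this
      have h0 : φ v' = 0 := hz ((hV.2.2.2.2 k).1 _ (hP _ _ hv'm) (by
        have := add_mem (hP _ _ hm) hq
        rw [← map_add, sub_add_cancel, hn] at this
        exact this))
      refine ⟨u - (ωU ^ k) v', ?_, by rw [map_sub, hn, h0]; simp⟩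
      simpa using neg_mem hm
    · obtain ⟨v', hv', hz⟩ := lift k u hu
      have h0 : φ v' = 0 := hz (by
        have := add_mem (hP _ _ hv') hq
        rwa [← map_add, sub_add_cancel] at this)
      refine ⟨u - v', ?_, by rw [map_sub, h0, sub_zero]⟩
      simpa using neg_mem hv'
  have main : ∀ i : ℤ, ∀ u : U, φ u ∈ Q i → ∃ u' ∈ P i, φ u' = φ u := by
    intro i u hq
    have key : ∀ m : ℕ, ∀ u ∈ P (i + m), φ u ∈ Q i → ∃ u' ∈ P i, φ u' = φ u := by
      intro m
      induction m with
      | zero => intro u hu _; exact ⟨u, by simpa using hu, rfl⟩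
      | succ m ih =>
        intro u hu hq
        obtain ⟨u1, hu1, e1⟩ := step _ u hu (hV.1 (by push_cast; linarith) hq)
        obtain ⟨u2, hu2, e2⟩ := ih u1 (hU.1 (by push_cast; linarith) hu1) (by rwa [e1])
        exact ⟨u2, hu2, e2.trans e1⟩
    obtain ⟨t, ht⟩ := hU.2.2.1
    exact key (t - i).toNat u (hU.1 (show t ≤ _ by omega) (by rw [ht]; trivial)) hq
  refine ⟨fun i => le_antisymm ?_ ?_, main⟩
  · exact le_inf LinearMap.map_le_range (hφP i)
  · rintro _ ⟨⟨u, rfl⟩, hu⟩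
    obtain ⟨u', h, e⟩ := main i u hu
    exact ⟨u', h, e⟩
end

section
/- Let K be a field of characteristic zero, V a K-vector space, and D, Y ∈ End(V) with D∘Y − Y∘D = id_V and D locally nilpotent. For v ∈ V define π(v) = Σ_{i≥0} (1/i!)·Y^i((−D)^i(v)); the sum is finite by local nilpotency of D. Then π is a K-linear idempotent (π∘π = π) whose image is ker D and whose kernel is Y(V); that is, π is the projection of V onto ker D along Y(V), and it restricts to the identity on ker D. -/
theorem weylaux_DY {K V : Type} [Field K] [AddCommGroup V] [Module K V]
    (D Y : Module.End K V) (h : ∀ v, D (Y v) = Y (D v) + v) (i : ℕ) (v : V) :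
    D ((Y ^ (i + 1)) v) = (Y ^ (i + 1)) (D v) + ((i : K) + 1) • (Y ^ i) v := by
  induction i with
  | zero => simp [h]
  | succ n ih =>
    rw [pow_succ' Y (n + 1), Module.End.mul_apply, h, ih, Module.End.mul_apply, map_add, map_smul,
      ← Module.End.mul_apply Y (Y ^ n), ← pow_succ']
    push_cast
    module

theorem weylaux_DnY {K V : Type} [Field K] [AddCommGroup V] [Module K V]
    (D Y : Module.End K V) (h : ∀ v, D (Y v) = Y (D v) + v) (i : ℕ) (v : V) :
    ((-D) ^ (i + 1)) (Y v) = Y (((-D) ^ (i + 1)) v) - ((i : K) + 1) • ((-D) ^ i) v := by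
  induction i with
  | zero => simp [h]; abel
  | succ n ih =>
    rw [pow_succ' (-D) (n + 1), Module.End.mul_apply, ih, Module.End.mul_apply, map_sub, map_smul,
      ← Module.End.mul_apply (-D) ((-D) ^ n), ← pow_succ', LinearMap.neg_apply, h,
      LinearMap.neg_apply, map_neg]
    push_cast
    module

noncomputable def weylS {K V : Type} [Field K] [AddCommGroup V] [Module K V]
    (D Y : Module.End K V) (N : ℕ) (v : V) : V :=
  ∑ i ∈ Finset.range N, ((i.factorial : K)⁻¹) • (Y ^ i) (((-D) ^ i) v)

theorem weylaux_DS {K V : Type} [Field K] [CharZero K] [AddCommGroup V] [Module K V]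
    (D Y : Module.End K V) (h : ∀ v, D (Y v) = Y (D v) + v) (N : ℕ) (v : V) :
    D (weylS D Y (N + 1) v) = -((N.factorial : K)⁻¹ • (Y ^ N) (((-D) ^ (N + 1)) v)) := by
  induction N with
  | zero => simp [weylS]
  | succ n ih =>
    rw [weylS, Finset.sum_range_succ, map_add, ← weylS, ih, map_smul, weylaux_DY D Y h,
      pow_succ' (-D) (n + 1), Module.End.mul_apply, LinearMap.neg_apply, map_neg, Nat.factorial_succ]
    have h1 : (n.factorial : K) ≠ 0 := by exact_mod_cast n.factorial_ne_zero
    have h2 : (n : K) + 1 ≠ 0 := by exact_mod_cast n.succ_ne_zero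
    push_cast
    match_scalars <;> field_simp <;> ring

theorem weylaux_SY {K V : Type} [Field K] [CharZero K] [AddCommGroup V] [Module K V]
    (D Y : Module.End K V) (h : ∀ v, D (Y v) = Y (D v) + v) (N : ℕ) (v : V) :
    weylS D Y (N + 1) (Y v) = (N.factorial : K)⁻¹ • (Y ^ (N + 1)) (((-D) ^ N) v) := by
  induction N with
  | zero => simp [weylS]
  | succ n ih =>
    rw [weylS, Finset.sum_range_succ, ← weylS, ih, weylaux_DnY D Y h, map_sub, map_smul,
      pow_succ Y (n + 1), Module.End.mul_apply, Nat.factorial_succ]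
    have h1 : (n.factorial : K) ≠ 0 := by exact_mod_cast n.factorial_ne_zero
    have h2 : (n : K) + 1 ≠ 0 := by exact_mod_cast n.succ_ne_zero
    push_cast
    match_scalars <;> field_simp <;> ring

theorem weylaux_range {K V : Type} [Field K] [AddCommGroup V] [Module K V]
    (D Y : Module.End K V) (N : ℕ) (v : V) :
    ∃ w, weylS D Y (N + 1) v = v + Y w := by
  induction N with
  | zero => exact ⟨0, by simp [weylS]⟩
  | succ n ih =>
    obtain ⟨w, hw⟩ := ih
    refine ⟨w + (((n + 1).factorial : K)⁻¹) • (Y ^ n) (((-D) ^ (n + 1)) v), ?_⟩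
    rw [weylS, Finset.sum_range_succ, ← weylS, hw, map_add, map_smul, pow_succ' Y n,
      Module.End.mul_apply, add_assoc]

theorem weylaux_neg {K V : Type} [Field K] [AddCommGroup V] [Module K V]
    (D : Module.End K V) (N M : ℕ) (hNM : N ≤ M) (v : V) (hv : (D ^ N) v = 0) :
    (D ^ M) v = 0 ∧ ((-D) ^ M) v = 0 := by
  have h1 : (D ^ M) v = 0 := by
    obtain ⟨k, rfl⟩ := Nat.exists_eq_add_of_le' hNM
    rw [pow_add, Module.End.mul_apply, hv, map_zero]
  refine ⟨h1, ?_⟩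
  rcases Nat.even_or_odd M with h | h
  · rw [h.neg_pow, h1]
  · rw [h.neg_pow, LinearMap.neg_apply, h1, neg_zero]

theorem weylaux_stable {K V : Type} [Field K] [AddCommGroup V] [Module K V]
    (D Y : Module.End K V) (N M : ℕ) (hNM : N ≤ M) (v : V) (hv : (D ^ N) v = 0) :
    weylS D Y M v = weylS D Y N v := by
  induction M, hNM using Nat.le_induction with
  | base => rfl
  | succ m hm ih =>
    rw [weylS, Finset.sum_range_succ, ← weylS, ih, (weylaux_neg D N m hm v hv).2]
    simp

/-- If `[D, Y] = 1` with `D` locally nilpotent, then the operator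
`π(v) = Σ_{i≥0} (1/i!)·Y^i((−D)^i(v))` (the sum is finite: all terms with `D^N v = 0`,
`i ≥ N`, vanish) is a linear idempotent with image `ker D` and kernel `Y(V)`: it is the
projection of `V` onto `ker D` along `Y(V)`, and restricts to the identity on `ker D`. -/
theorem weyl_projection
    (K : Type) [Field K] [CharZero K]
    (V : Type) [AddCommGroup V] [Module K V]
    (D Y : Module.End K V)
    (hcomm : D * Y - Y * D = 1)
    (hnil : ∀ v : V, ∃ n : ℕ, (D ^ n) v = 0) :
    ∃ π : V →ₗ[K] V,
      -- π is given by the finite sum Σ_i (1/i!)·Y^i((−D)^i v)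
      (∀ (v : V) (N : ℕ), (D ^ N) v = 0 →
        π v = ∑ i ∈ Finset.range N,
          ((i.factorial : K)⁻¹) • (Y ^ i) (((-D) ^ i) v)) ∧
      π ∘ₗ π = π ∧
      LinearMap.range π = LinearMap.ker D ∧
      LinearMap.ker π = LinearMap.range Y ∧
      (∀ v ∈ LinearMap.ker D, π v = v) := by
  have h : ∀ v, D (Y v) = Y (D v) + v := fun v => by
    have := LinearMap.congr_fun hcomm v
    simp only [LinearMap.sub_apply, Module.End.mul_apply, Module.End.one_apply] at this
    rw [← sub_eq_iff_eq_add']; exact this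
  choose n hn using hnil
  have key : ∀ (v : V) (N : ℕ), (D ^ N) v = 0 → weylS D Y (n v) v = weylS D Y N v := by
    intro v N hN
    rw [← weylaux_stable D Y N (max N (n v)) (le_max_left _ _) v hN,
      ← weylaux_stable D Y (n v) (max N (n v)) (le_max_right _ _) v (hn v)]
  let π : V →ₗ[K] V :=
    { toFun := fun v => weylS D Y (n v) v
      map_add' := by
        intro x y
        have hx := (weylaux_neg D _ _ (le_max_left (n x) (n y)) x (hn x)).1
        have hy := (weylaux_neg D _ _ (le_max_right (n x) (n y)) y (hn y)).1
        rw [key x _ hx, key y _ hy, key (x + y) (max (n x) (n y)) (by rw [map_add, hx, hy, add_zero])]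
        simp [weylS, Finset.sum_add_distrib]
      map_smul' := by
        intro c x
        rw [key (c • x) (n x) (by rw [map_smul, hn, smul_zero])]
        simp only [weylS, map_smul, Finset.smul_sum, RingHom.id_apply]
        exact Finset.sum_congr rfl fun i _ => smul_comm _ _ _ }
  have hπ : ∀ (v : V) (N : ℕ), (D ^ N) v = 0 → π v = weylS D Y N v := key
  have hπ1 : ∀ v, π v = weylS D Y (n v + 1) v := fun v =>
    hπ v _ (weylaux_neg D _ _ (Nat.le_succ _) v (hn v)).1
  have hD : ∀ v, D (π v) = 0 := fun v => by
    rw [hπ1, weylaux_DS D Y h, (weylaux_neg D _ _ (Nat.le_succ _) v (hn v)).2]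
    simp
  have hid : ∀ v ∈ LinearMap.ker D, π v = v := fun v hv => by
    rw [hπ v 1 (by simpa using hv)]
    simp [weylS]
  refine ⟨π, hπ, ?_, ?_, ?_, hid⟩
  · ext v
    exact hid _ (hD v)
  · ext v
    constructor
    · rintro ⟨w, rfl⟩
      exact hD w
    · intro hv
      exact ⟨v, hid v hv⟩
  · ext v
    constructor
    · intro hv
      obtain ⟨w, hw⟩ := weylaux_range D Y (n v) v
      rw [← hπ1, LinearMap.mem_ker.1 hv] at hw
      exact ⟨-w, by rw [map_neg]; exact (eq_neg_of_add_eq_zero_left hw.symm).symm⟩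
    · rintro ⟨w, rfl⟩
      rw [LinearMap.mem_ker]
      let N := max (n w) (n (Y w))
      rw [hπ (Y w) (N + 1)
        (weylaux_neg D _ _ ((le_max_right _ _).trans (Nat.le_succ _)) _ (hn (Y w))).1,
        weylaux_SY D Y h, (weylaux_neg D _ _ (le_max_left _ _) w (hn w)).2]
      simp
end

section
/- Let K be a field of characteristic zero, V a K-vector space, and D, Y ∈ End(V) with D∘Y − Y∘D = id_V and D locally nilpotent. Let f ∈ End(V) be such that the adjoint operators ad_D and ad_Y are nilpotent at f, i.e. there exists N with ad_D^N(f) = 0 and ad_Y^N(f) = 0, where ad_A(B) = A∘B − B∘A. Then there exists a unique finite family (f_{ij})_{0 ≤ i,j < N} of endomorphisms of V, each commuting with both D and Y, such that f = Σ_{i,j} Y^i ∘ f_{ij} ∘ D^j. -/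
section helpers
variable {K W : Type*} [Field K] [CharZero K] [AddCommGroup W] [Module K W]

lemma wbd_pow (P M : Module.End K W) (h : ∀ w, P (M w) = w + M (P w)) (c : W) (hc : P c = 0)
    (n : ℕ) : P ((M ^ (n + 1)) c) = ((n : K) + 1) • (M ^ n) c := by
  induction n with
  | zero => simp [h, hc]
  | succ n ih =>
    rw [pow_succ' M (n + 1), Module.End.mul_apply, h, ih, map_smul, ← Module.End.mul_apply,
      ← pow_succ']
    push_cast
    module

lemma wbd_uniq (P M : Module.End K W) (h : ∀ w, P (M w) = w + M (P w)) (N : ℕ) :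
    ∀ g : ℕ → W, (∀ i < N, P (g i) = 0) → ∑ i ∈ Finset.range N, (M ^ i) (g i) = 0 →
      ∀ i < N, g i = 0 := by
  induction N with
  | zero => intro g _ _ i hi; omega
  | succ N ih =>
    intro g hg hs
    have h1 : ∀ i < N, g (i + 1) = 0 := by
      have h2 := congrArg P hs
      rw [Finset.sum_range_succ', map_add, map_sum, map_zero, pow_zero, Module.End.one_apply,
        hg 0 (by omega), add_zero] at h2
      have h3 := ih (fun i => ((i : K) + 1) • g (i + 1))
        (fun i hi => by simp [hg (i + 1) (by omega)]) (by
          rw [← h2]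
          refine Finset.sum_congr rfl fun i hi => ?_
          rw [wbd_pow P M h _ (hg _ (by simpa using hi)), map_smul])
      intro i hi
      exact (smul_eq_zero.mp (h3 i hi)).resolve_left (Nat.cast_add_one_ne_zero i)
    intro i hi
    cases i with
    | succ i => exact h1 i (by omega)
    | zero =>
      rw [Finset.sum_range_succ', Finset.sum_eq_zero] at hs
      · simpa using hs
      · intro i hi
        rw [h1 i (by simpa using hi), map_zero]

lemma wbd_exists (P M : Module.End K W) (h : ∀ w, P (M w) = w + M (P w)) (N : ℕ) :
    ∀ f : W, (P ^ N) f = 0 → ∃ g : ℕ → W, (∀ i < N, P (g i) = 0) ∧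
      f = ∑ i ∈ Finset.range N, (M ^ i) (g i) := by
  induction N with
  | zero => intro f hf; exact ⟨0, by simp, by simpa using hf⟩
  | succ N ih =>
    intro f hf
    obtain ⟨g, hg, hs⟩ := ih (P f) (by rwa [← Module.End.mul_apply, ← pow_succ])
    let F := ∑ i ∈ Finset.range N, (M ^ (i + 1)) (((i : K) + 1)⁻¹ • g i)
    have hF : P F = P f := by
      rw [hs, map_sum]
      refine Finset.sum_congr rfl fun i hi => ?_
      rw [wbd_pow P M h _ (by simp [hg i (by simpa using hi)]), map_smul, smul_smul,
        mul_inv_cancel₀ (Nat.cast_add_one_ne_zero i), one_smul]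
    refine ⟨fun i => Nat.casesOn i (f - F) (fun i => ((i : K) + 1)⁻¹ • g i), ?_, ?_⟩
    · intro i hi
      cases i with
      | zero => simp [hF]
      | succ i => simp [hg i (by omega)]
    · rw [Finset.sum_range_succ']
      simp [F]

lemma wbd_two (P M Q L : Module.End K W) (h : ∀ w, P (M w) = w + M (P w))
    (h' : ∀ w, Q (L w) = w + L (Q w)) (hPL : Commute P L) (hQM : Commute Q M)
    (hPQ : Commute P Q) (N : ℕ) (f : W) (hP : (P ^ N) f = 0)
    (hQ : (Q ^ N) f = 0) :
    ∃! g : Fin N → Fin N → W, (∀ i j, P (g i j) = 0 ∧ Q (g i j) = 0) ∧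
      f = ∑ i : Fin N, ∑ j : Fin N, (M ^ (i : ℕ)) ((L ^ (j : ℕ)) (g i j)) := by
  have comm : ∀ {A B : Module.End K W}, Commute A B → ∀ w, A (B w) = B (A w) :=
    fun hAB w => by rw [← Module.End.mul_apply, hAB.eq, Module.End.mul_apply]
  obtain ⟨a, ha, hfa⟩ := wbd_exists P M h N f hP
  have hQa : ∀ i < N, (Q ^ N) (a i) = 0 := by
    refine wbd_uniq P M h N (fun i => (Q ^ N) (a i)) (fun i hi => ?_) ?_
    · rw [comm (hPQ.pow_right N), ha i hi, map_zero]
    · rw [← hQ]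
      conv_rhs => rw [hfa]
      rw [map_sum]
      exact Finset.sum_congr rfl fun i _ => (comm (hQM.pow_pow N i) _).symm
  have hb : ∀ i : Fin N, ∃ b : ℕ → W, (∀ j < N, Q (b j) = 0) ∧
      a i = ∑ j ∈ Finset.range N, (L ^ j) (b j) :=
    fun i => wbd_exists Q L h' N (a i) (hQa i i.2)
  choose b hb1 hb2 using hb
  refine ⟨fun i j => b i j, ⟨fun i j => ⟨?_, hb1 i j j.2⟩, ?_⟩, ?_⟩
  · refine wbd_uniq Q L h' N (fun j => P (b i j)) (fun j hj => ?_) ?_ j j.2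
    · rw [← comm hPQ, hb1 i j hj, map_zero]
    · rw [← ha i i.2, hb2 i, map_sum]
      exact Finset.sum_congr rfl fun j _ => (comm (hPL.pow_right j) _).symm
  · rw [hfa, Finset.sum_range]
    refine Finset.sum_congr rfl fun i _ => ?_
    rw [hb2 i, Finset.sum_range, map_sum]
  · rintro g ⟨hg, hfg⟩
    have e1 : ∀ i : Fin N, ∑ j : Fin N, (L ^ (j : ℕ)) (g i j) = a i := by
      have := wbd_uniq P M h N
        (fun i => (if hi : i < N then ∑ j : Fin N, (L ^ (j : ℕ)) (g ⟨i, hi⟩ j) else 0) - a i)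
        (fun i hi => by
          simp only [hi, dif_pos, map_sub, ha i hi, map_sum, sub_zero]
          refine Finset.sum_eq_zero fun j _ => ?_
          rw [comm (hPL.pow_right _), (hg _ _).1, map_zero])
        (by
          simp only [map_sub, Finset.sum_sub_distrib]
          rw [← hfa, Finset.sum_range, sub_eq_zero]
          conv_rhs => rw [hfg]
          simp [map_sum])
      intro i
      simpa [sub_eq_zero] using this i i.2
    funext i j
    have := wbd_uniq Q L h' N (fun j => (if hj : j < N then g i ⟨j, hj⟩ else 0) - b i j)
      (fun j hj => by simp [hj, (hg _ _).2, hb1 i j hj])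
      (by
        simp only [map_sub, Finset.sum_sub_distrib]
        rw [← hb2, Finset.sum_range, sub_eq_zero, ← e1 i]
        simp)
    simpa [sub_eq_zero] using this j j.2

end helpers

/-- If `[D, Y] = 1` with `D` locally nilpotent, and `f` is an endomorphism on which the
adjoint operators `ad_D` and `ad_Y` are nilpotent (say of order `N`), then `f` decomposes
uniquely as `f = Σ_{0 ≤ i,j < N} Y^i ∘ f_{ij} ∘ D^j` with each `f_{ij}` commuting with
both `D` and `Y`. -/
theorem weyl_bimodule_decomposition
    (K : Type) [Field K] [CharZero K]
    (V : Type) [AddCommGroup V] [Module K V]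
    (D Y : Module.End K V)
    (hcomm : D * Y - Y * D = 1)
    (hnil : ∀ v : V, ∃ n : ℕ, (D ^ n) v = 0)
    (f : Module.End K V) (N : ℕ)
    (hadD : (fun g => D * g - g * D)^[N] f = 0)
    (hadY : (fun g => Y * g - g * Y)^[N] f = 0) :
    ∃! g : Fin N → Fin N → Module.End K V,
      (∀ i j, Commute (g i j) D ∧ Commute (g i j) Y) ∧
      f = ∑ i : Fin N, ∑ j : Fin N, Y ^ (i : ℕ) * g i j * D ^ (j : ℕ) := by
  let P : Module.End K (Module.End K V) := LinearMap.mulLeft K D - LinearMap.mulRight K D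
  let Q : Module.End K (Module.End K V) := LinearMap.mulRight K Y - LinearMap.mulLeft K Y
  let M : Module.End K (Module.End K V) := LinearMap.mulLeft K Y
  let L : Module.End K (Module.End K V) := LinearMap.mulRight K D
  have hP : ∀ g, P g = D * g - g * D := fun g => by simp [P]
  have hQ : ∀ g, Q g = g * Y - Y * g := fun g => by simp [Q]
  have hM : ∀ g, M g = Y * g := fun g => by simp [M]
  have hL : ∀ g, L g = g * D := fun g => by simp [L]
  have hDY : D * Y = 1 + Y * D := sub_eq_iff_eq_add.mp hcomm
  have hMn : ∀ n g, (M ^ n) g = Y ^ n * g := fun n g => by simp [M, LinearMap.pow_mulLeft]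
  have hLn : ∀ n g, (L ^ n) g = g * D ^ n := fun n g => by simp [L, LinearMap.pow_mulRight]
  have key := wbd_two P M Q L
    (fun w => by
      rw [hM, hP, hM, hP, ← mul_assoc, hDY]; noncomm_ring)
    (fun w => by
      rw [hL, hQ, hL, hQ, mul_assoc, hDY]; noncomm_ring)
    (LinearMap.ext fun w => by
      simp only [Module.End.mul_apply, hP, hL]; noncomm_ring)
    (LinearMap.ext fun w => by
      simp only [Module.End.mul_apply, hQ, hM]; noncomm_ring)
    (LinearMap.ext fun w => by
      simp only [Module.End.mul_apply, hP, hQ]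
      have e1 : D * (w * Y - Y * w) - (w * Y - Y * w) * D
          = D * w * Y - (D * Y) * w - w * (Y * D) + Y * w * D := by noncomm_ring
      have e2 : (D * w - w * D) * Y - Y * (D * w - w * D)
          = D * w * Y - w * (D * Y) - (Y * D) * w + Y * w * D := by noncomm_ring
      rw [e1, e2, hDY]; noncomm_ring)
    N f
    (by
      rw [Module.End.pow_apply, ← hadD]
      congr 2)
    (by
      have this : ∀ n, (fun g => Y * g - g * Y)^[n] f = (-1 : K) ^ n • (Q ^ n) f := by
        intro n
        induction n with
        | zero => simp
        | succ n ih =>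
          rw [Function.iterate_succ_apply', ih, pow_succ' Q, Module.End.mul_apply, hQ,
            pow_succ, mul_smul, neg_one_smul, neg_sub, smul_sub, mul_smul_comm, smul_mul_assoc]
      rw [this] at hadY
      exact (smul_eq_zero.mp hadY).resolve_left (by simp))
  have hiff : ∀ g : Module.End K V, (P g = 0 ∧ Q g = 0) ↔ (Commute g D ∧ Commute g Y) := by
    intro g
    rw [hP, hQ, sub_eq_zero, sub_eq_zero]
    exact and_congr eq_comm Iff.rfl
  simpa only [hiff, hMn, hLn, ← mul_assoc] using key
end
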